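/- arXiv:1611.08236 — 6 statements merged into one kernel-verified Lean document; each statement's English description precedes it below -/
import Mathlib

section
/- Let g : ℝ^m → ℝ^p be twice Fréchet differentiable at ȳ ∈ ℝ^m and let v ∈ ℝ^m with v ≠ 0. If the implication [∇g(ȳ)ᵀλ = 0 and (vᵀ∇²g(ȳ))ᵀλ + ∇g(ȳ)ᵀμ = 0] ⟹ λ = 0 holds for all λ, μ ∈ ℝ^p, then there are positive numbers ε, δ and κ such that for all (y,z) ∈ (ȳ, g(ȳ)) + V_{ε,δ}((v, ∇g(ȳ)v)) with y ≠ ȳ and ‖z − g(y)‖ ≤ δ‖y − ȳ‖², one has dist(y, g⁻¹(z)) ≤ (κ/‖y − ȳ‖)·‖z − g(y)‖. -/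
open Set Filter Topology Metric RealInnerProductSpace

noncomputable section

/-- Euclidean space `ℝ^d`. -/
abbrev Em (d : ℕ) : Type := EuclideanSpace ℝ (Fin d)

section General

variable {H : Type*} [NormedAddCommGroup H] [NormedSpace ℝ H]

/-- Bouligand tangent (contingent) cone to `Ω` at `z`. -/
def tanCone (Ω : Set H) (z : H) : Set H :=
  {u | ∃ (t : ℕ → ℝ) (uk : ℕ → H), (∀ k, 0 < t k) ∧ Tendsto t atTop (𝓝 0) ∧
    Tendsto uk atTop (𝓝 u) ∧ ∀ k, z + t k • uk k ∈ Ω}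

open Classical in
/-- The set `V_{ε,δ}(v)`. -/
def Vset (eps delta : ℝ) (v : H) : Set H :=
  if v = 0 then Metric.closedBall 0 eps
  else {0} ∪ {u | u ∈ Metric.closedBall (0:H) eps ∧ u ≠ 0 ∧
    ‖‖u‖⁻¹ • u - ‖v‖⁻¹ • v‖ ≤ delta}

end General

section InnerSp

variable {H : Type*} [NormedAddCommGroup H] [InnerProductSpace ℝ H]

/-- Negative polar cone. -/
def polarCone (K : Set H) : Set H := {x | ∀ y ∈ K, ⟪x, y⟫ ≤ 0}

/-- Regular (Fréchet) normal cone. -/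
def regNormalCone (Ω : Set H) (z : H) : Set H := polarCone (tanCone Ω z)

/-- Limiting (Mordukhovich) normal cone. -/
def limNormalCone (Ω : Set H) (z : H) : Set H :=
  {x | ∃ (zk xk : ℕ → H), (∀ k, zk k ∈ Ω) ∧ (∀ k, xk k ∈ regNormalCone Ω (zk k)) ∧
    Tendsto zk atTop (𝓝 z) ∧ Tendsto xk atTop (𝓝 x)}

end InnerSp

section ProdSp

variable {E F : Type*} [NormedAddCommGroup E] [InnerProductSpace ℝ E]
  [NormedAddCommGroup F] [InnerProductSpace ℝ F]

/-- Negative polar w.r.t. the natural pairing on a product of inner product spaces. -/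
def polarConeP (K : Set (E × F)) : Set (E × F) :=
  {p | ∀ q ∈ K, ⟪p.1, q.1⟫ + ⟪p.2, q.2⟫ ≤ 0}

/-- Regular normal cone in a product space. -/
def regNormalConeP (Ω : Set (E × F)) (z : E × F) : Set (E × F) :=
  polarConeP (tanCone Ω z)

/-- Limiting normal cone in a product space. -/
def limNormalConeP (Ω : Set (E × F)) (z : E × F) : Set (E × F) :=
  {x | ∃ (zk xk : ℕ → E × F), (∀ k, zk k ∈ Ω) ∧
    (∀ k, xk k ∈ regNormalConeP Ω (zk k)) ∧
    Tendsto zk atTop (𝓝 z) ∧ Tendsto xk atTop (𝓝 x)}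

/-- Directional limiting normal cone in a product space. -/
def dirLimNormalConeP (Ω : Set (E × F)) (z u : E × F) : Set (E × F) :=
  {x | ∃ (t : ℕ → ℝ) (uk xk : ℕ → E × F), (∀ k, 0 < t k) ∧ Tendsto t atTop (𝓝 0) ∧
    Tendsto uk atTop (𝓝 u) ∧ Tendsto xk atTop (𝓝 x) ∧
    ∀ k, xk k ∈ regNormalConeP Ω (z + t k • uk k)}

end ProdSp

section Metr

variable {X Y : Type*} [PseudoMetricSpace X] [PseudoMetricSpace Y]

/-- `Ψ` is metrically regular near `(ub, vb)` with modulus `κ`. -/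
def MetricallyRegularNear (Ψ : X → Set Y) (ub : X) (vb : Y) (κ : ℝ) : Prop :=
  ∃ U ∈ 𝓝 ub, ∃ V ∈ 𝓝 vb, ∀ u ∈ U, ∀ v ∈ V,
    EMetric.infEdist u {x | v ∈ Ψ x} ≤ ENNReal.ofReal κ * EMetric.infEdist v (Ψ u)

/-- `Ψ` is metrically subregular at `(ub, vb)`. -/
def MetricallySubregularAt (Ψ : X → Set Y) (ub : X) (vb : Y) : Prop :=
  ∃ κ > (0:ℝ), ∃ U ∈ 𝓝 ub, ∀ u ∈ U,
    EMetric.infEdist u {x | vb ∈ Ψ x} ≤ ENNReal.ofReal κ * EMetric.infEdist vb (Ψ u)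

end Metr

section TwoDiff

variable {m p : ℕ}

/-- `g` is twice Fréchet differentiable at `ȳ`. -/
def TwiceDiffAt (g : Em m → Em p) (yb : Em m) : Prop :=
  (∀ᶠ y in 𝓝 yb, DifferentiableAt ℝ g y) ∧ DifferentiableAt ℝ (fderiv ℝ g) yb

/-- Adjoint (transpose) of a continuous linear map between Euclidean spaces. -/
def adjA (A : Em m →L[ℝ] Em p) : Em p →L[ℝ] Em m := ContinuousLinearMap.adjoint A

end TwoDiff

section Q

variable {m l : ℕ}

/-- The feasible set `Γ = {y : q i y ≤ 0 ∀ i}`. -/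
def Gam (q : Em m → Em l) : Set (Em m) := {y | ∀ i, q y i ≤ 0}

/-- `∇q_i(y)v`. -/
def gradQ (q : Em m → Em l) (y : Em m) (i : Fin l) (v : Em m) : ℝ := fderiv ℝ q y v i

/-- `vᵀ∇²q_i(y)w`. -/
def hessQ (q : Em m → Em l) (y : Em m) (i : Fin l) (v w : Em m) : ℝ :=
  fderiv ℝ (fderiv ℝ q) y v w i

/-- `∇q(y)ᵀλ`. -/
def gradT (q : Em m → Em l) (y : Em m) (lam : Em l) : Em m :=
  ContinuousLinearMap.adjoint (fderiv ℝ q y) lam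

/-- `∇²(λᵀq)(y)v = (vᵀ∇²q(y))ᵀλ`. -/
def hessT (q : Em m → Em l) (y : Em m) (lam : Em l) (v : Em m) : Em m :=
  ContinuousLinearMap.adjoint (fderiv ℝ (fderiv ℝ q) y v) lam

/-- The perturbation mapping `M_q(y) = q(y) - ℝ^l_-`. -/
def Mq (q : Em m → Em l) (y : Em m) : Set (Em l) := {z | ∀ i, q y i ≤ z i}

/-- `M_q` is metrically regular in the vicinity of `ȳ`. -/
def MetricallyRegularInVicinity (q : Em m → Em l) (yb : Em m) : Prop :=
  ∃ V ∈ 𝓝 yb, ∃ κ > (0:ℝ), ∀ y ∈ V, y ≠ yb → (0:Em l) ∈ Mq q y →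
    MetricallyRegularNear (Mq q) y (0:Em l) κ

/-- Active index set `I(y)`. -/
def actI (q : Em m → Em l) (y : Em m) : Set (Fin l) := {i | q y i = 0}

/-- `Ī(v) = {i ∈ I(ȳ) : ∇q_i(ȳ)v = 0}`. -/
def IbarDir (q : Em m → Em l) (yb v : Em m) : Set (Fin l) :=
  {i | q yb i = 0 ∧ gradQ q yb i v = 0}

/-- Linearized cone `T^lin(ȳ)`. -/
def Tlin (q : Em m → Em l) (yb : Em m) : Set (Em m) :=
  {v | ∀ i ∈ actI q yb, gradQ q yb i v ≤ 0}

/-- The normal cone `N_{ℝ^l_-}(q(y))`. -/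
def NRl (q : Em m → Em l) (y : Em m) : Set (Em l) :=
  {mu | (∀ i, 0 ≤ mu i) ∧ ∀ i, q y i ≠ 0 → mu i = 0}

/-- Lagrange multiplier set `Λ(y, y*)`. -/
def Lam (q : Em m → Em l) (y ystar : Em m) : Set (Em l) :=
  {lam | lam ∈ NRl q y ∧ gradT q y lam = ystar}

/-- Directional multiplier set `Λ(y, y*; v)`. -/
def LamDir (q : Em m → Em l) (yb ystar v : Em m) : Set (Em l) :=
  {lam | lam ∈ Lam q yb ystar ∧ ∀ lam' ∈ Lam q yb ystar,
    ∑ i, lam' i * hessQ q yb i v v ≤ ∑ i, lam i * hessQ q yb i v v}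

/-- The set `M̄(v, v*)`. -/
def Mbar (q : Em m → Em l) (yb ystar v vstar : Em m) : Set (Em l × Em l) :=
  {p | p.1 ∈ LamDir q yb ystar v ∧ p.2 ∈ tanCone (NRl q yb) p.1 ∧
    vstar = hessT q yb p.1 v + gradT q yb p.2}

/-- `I⁺(λ)`. -/
def Iplus (lam : Em l) : Set (Fin l) := {i | 0 < lam i}

/-- `I⁺(λ, μ)`. -/
def IplusLM (lam mu : Em l) : Set (Fin l) := {i | 0 < lam i} ∪ {i | lam i = 0 ∧ 0 < mu i}

/-- `P_{I⁺,I}`. -/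
def Pset (Ip I : Set (Fin l)) : Set (Em l) :=
  {mu | (∀ i ∉ I, mu i = 0) ∧ ∀ i ∈ I \ Ip, 0 ≤ mu i}

/-- `K̄_{I⁺,I}`. -/
def Kcone (q : Em m → Em l) (yb : Em m) (Ip I : Set (Fin l)) : Set (Em m) :=
  {w | (∀ i ∈ Ip, gradQ q yb i w = 0) ∧ ∀ i ∈ I \ Ip, gradQ q yb i w ≤ 0}

/-- `K̄_{I⁺,I}(v)`. -/
def KconeDir (q : Em m → Em l) (yb : Em m) (Ip I : Set (Fin l)) (v : Em m) : Set (Em m) :=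
  {w | w ∈ Kcone q yb Ip I ∧ ∃ z : Em m,
    (∀ i ∈ Ip, gradQ q yb i z + hessQ q yb i v w = 0) ∧
    ∀ i ∈ I \ Ip, gradQ q yb i z + hessQ q yb i v w ≤ 0}

/-- `Q(v, λ, I⁺, I)`. -/
def Qset (q : Em m → Em l) (yb v : Em m) (lam : Em l) (Ip I : Set (Fin l)) :
    Set (Em m × Em m) :=
  {p | p.2 ∈ KconeDir q yb Ip I v ∧
    p.1 + hessT q yb lam p.2 ∈ polarCone (KconeDir q yb Ip I v)}

/-- `Q₀(v, λ, I⁺, I)`. -/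
def Qzero (q : Em m → Em l) (yb v : Em m) (lam : Em l) (Ip I : Set (Fin l)) :
    Set (Em m × Em m) :=
  {p | p.2 ∈ KconeDir q yb Ip I v ∧
    ∃ mu ∈ Pset Ip I, p.1 + hessT q yb lam p.2 = gradT q yb mu}

/-- `Ξ̄(v)`, the feasible set of the dual program. -/
def Xibar (q : Em m → Em l) (yb v : Em m) : Set (Em m) :=
  {z | ∀ i ∈ actI q yb, gradQ q yb i z + hessQ q yb i v v ≤ 0}

/-- `J(z)`. -/
def Jset (q : Em m → Em l) (yb v z : Em m) : Set (Fin l) :=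
  {i | i ∈ IbarDir q yb v ∧ gradQ q yb i z + hessQ q yb i v v = 0}

/-- `J̄(v)`. -/
def Jbar (q : Em m → Em l) (yb v : Em m) : Set (Set (Fin l)) :=
  {J | ∃ z ∈ Xibar q yb v, J = Jset q yb v z}

/-- `J` is a maximal element of `J̄(v)`. -/
def MaximalJ (q : Em m → Em l) (yb v : Em m) (J : Set (Fin l)) : Prop :=
  J ∈ Jbar q yb v ∧ ∀ J' ∈ Jbar q yb v, J ⊆ J' → J = J'

/-- `(q_i)_{i ∈ J}` is 2-regular at `ȳ` in direction `v`. -/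
def TwoRegular (q : Em m → Em l) (yb v : Em m) (J : Set (Fin l)) : Prop :=
  ∀ α : Fin l → ℝ, ∃ u w : Em m,
    (∀ i ∈ J, gradQ q yb i u + hessQ q yb i v w = α i) ∧ ∀ i ∈ J, gradQ q yb i w = 0

/-- 2-LICQ holds at `ȳ` in direction `v`. -/
def TwoLICQ (q : Em m → Em l) (yb v : Em m) : Prop :=
  ∃ eps > (0:ℝ), ∃ delta > (0:ℝ), ∀ y : Em m, y - yb ∈ Vset eps delta v →
    y ∈ Gam q → y ≠ yb → TwoRegular q yb v (actI q y)

/-- Gradient vector of `q_i` at `y`. -/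
def gradF (q : Em m → Em l) (y : Em m) (i : Fin l) : Em m := gradient (fun x => q x i) y

/-- LICQ holds at `y`. -/
def LICQat (q : Em m → Em l) (y : Em m) : Prop :=
  LinearIndependent ℝ (fun i : actI q y => gradF q y (i : Fin l))

/-- Graph of the regular normal cone mapping `N̂_Γ`. -/
def GphNhat (q : Em m → Em l) : Set (Em m × Em m) :=
  {p | p.1 ∈ Gam q ∧ p.2 ∈ regNormalCone (Gam q) p.1}

/-- Critical cone `K̄ = T_Γ(ȳ) ∩ (ȳ*)^⊥`. -/
def Kbar (q : Em m → Em l) (yb ystar : Em m) : Set (Em m) :=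
  {v | v ∈ tanCone (Gam q) yb ∧ ⟪ystar, v⟫ = 0}

/-- The null space `N(ȳ)` of the active gradients. -/
def Nspace (q : Em m → Em l) (yb : Em m) : Set (Em m) :=
  {v | ∀ i ∈ actI q yb, gradQ q yb i v = 0}

/-- The union `⋃_{(λ,μ),J} ⋃_{I⁺,I} Q(v,λ,I⁺,I)`. -/
def unionQ (q : Em m → Em l) (yb ystar v vstar : Em m) : Set (Em m × Em m) :=
  {p | ∃ lam mu : Em l, (lam, mu) ∈ Mbar q yb ystar v vstar ∧
    ∃ J ∈ Jbar q yb v, ∃ Ip I : Set (Fin l),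
      IplusLM lam mu ⊆ Ip ∧ Ip ⊆ I ∧ I ⊆ J ∧ p ∈ Qset q yb v lam Ip I}

/-- The cone `N¹_{gph N̂_Γ}((ȳ,ȳ*);(0,v*))`. -/
def N1cone (q : Em m → Em l) (yb ystar vstar : Em m) : Set (Em m × Em m) :=
  {p | ∃ (t : ℕ → ℝ) (vk vks wks wk : ℕ → Em m),
    (∀ k, 0 < t k) ∧ Tendsto t atTop (𝓝 0) ∧ (∀ k, vk k ≠ 0) ∧
    Tendsto vk atTop (𝓝 0) ∧ Tendsto vks atTop (𝓝 vstar) ∧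
    Tendsto (fun k => (wks k, wk k)) atTop (𝓝 p) ∧
    ∀ k, (wks k, wk k) ∈ regNormalConeP (GphNhat q) (yb + t k • vk k, ystar + t k • vks k)}

/-- The cone `N²_{gph N̂_Γ}((ȳ,ȳ*);(0,v*))`. -/
def N2cone (q : Em m → Em l) (yb ystar vstar : Em m) : Set (Em m × Em m) :=
  {p | ∃ (t : ℕ → ℝ) (vks wks wk : ℕ → Em m),
    (∀ k, 0 < t k) ∧ Tendsto t atTop (𝓝 0) ∧
    Tendsto vks atTop (𝓝 vstar) ∧
    Tendsto (fun k => (wks k, wk k)) atTop (𝓝 p) ∧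
    ∀ k, (wks k, wk k) ∈ regNormalConeP (GphNhat q) (yb, ystar + t k • vks k)}

/-- The union over unit directions in `K̄` appearing in Theorem 7(2). -/
def unionQdir (q : Em m → Em l) (yb ystar vstar : Em m) : Set (Em m × Em m) :=
  {p | ∃ vt : Em m, vt ∈ Kbar q yb ystar ∧ ‖vt‖ = 1 ∧
    ∃ lam mu : Em l, (lam, mu) ∈ Mbar q yb ystar 0 vstar ∧ lam ∈ LamDir q yb ystar vt ∧
    ∃ J ∈ Jbar q yb vt, ∃ Ip I : Set (Fin l),
      IplusLM lam mu ⊆ Ip ∧ Ip ⊆ I ∧ I ⊆ J ∧ p ∈ Qset q yb vt lam Ip I}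

/-- `Λ̄^E(v)`. -/
def LamE (q : Em m → Em l) (yb ystar v : Em m) : Set (Em l) :=
  LamDir q yb ystar v ∩ convexHull ℝ (Set.extremePoints ℝ (Lam q yb ystar))

open Classical in
/-- `Λ̃̄^E(v)`. -/
def LamEt (q : Em m → Em l) (yb ystar v : Em m) : Set (Em l) :=
  if v = 0 then convexHull ℝ (⋃ u ∈ Kbar q yb ystar \ {0}, LamE q yb ystar u)
  else LamE q yb ystar v

/-- The union appearing in Proposition 5 (with `Q₀` and `Λ̃̄^E(ṽ)`). -/
def unionQ0 (q : Em m → Em l) (yb ystar vstar vt : Em m) : Set (Em m × Em m) :=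
  {p | ∃ lam mu : Em l, (lam, mu) ∈ Mbar q yb ystar 0 vstar ∧ lam ∈ LamEt q yb ystar vt ∧
    ∃ J ∈ Jbar q yb vt, ∃ Ip I : Set (Fin l),
      IplusLM lam mu ⊆ Ip ∧ Ip ⊆ I ∧ I ⊆ J ∧ p ∈ Qzero q yb vt lam Ip I}

end Q

section Aubin

/-- The Aubin property of `S` around `(xb, yb)`. -/
def AubinProperty {n m : ℕ} (S : Em n → Set (Em m)) (xb : Em n) (yb : Em m) : Prop :=
  ∃ U ∈ 𝓝 xb, ∃ V ∈ 𝓝 yb, ∃ κ : ℝ, 0 ≤ κ ∧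
    ∀ x1 ∈ U, ∀ x2 ∈ U, ∀ y ∈ S x1 ∩ V, ∃ y' ∈ S x2, ‖y - y'‖ ≤ κ * ‖x1 - x2‖

end Aubin

end

/-- A surjectivity criterion: if `g` pulled back along `R` has derivative close to the identity on
a ball, then every target `z` is attained near `y`. -/
lemma exists_eq_of_norm_fderiv_comp_sub_id_le {E F : Type*} [NormedAddCommGroup E]
    [NormedSpace ℝ E] [NormedAddCommGroup F] [NormedSpace ℝ F] [CompleteSpace F]
    {g : E → F} {y : E} {z : F} (R : F →L[ℝ] E)
    (hR : ∀ q : F, ‖q‖ ≤ 2 * ‖z - g y‖ → DifferentiableAt ℝ g (y + R q) ∧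
      ‖(fderiv ℝ g (y + R q)).comp R - ContinuousLinearMap.id ℝ F‖ ≤ 1 / 2) :
    ∃ q : F, ‖q‖ ≤ 2 * ‖z - g y‖ ∧ g (y + R q) = z := by
  set ρ := 2 * ‖z - g y‖ with hρ
  have hderiv : ∀ q ∈ closedBall (0 : F) ρ, HasFDerivWithinAt (fun q => g (y + R q))
      ((fderiv ℝ g (y + R q)).comp R) (closedBall (0 : F) ρ) q := by
    intro q hq
    have h1 := (hR q (by simpa using hq)).1.hasFDerivAt
    exact (h1.comp q (R.hasFDerivAt.const_add y)).hasFDerivWithinAt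
  have happ : ApproximatesLinearOn (fun q => g (y + R q)) (ContinuousLinearMap.id ℝ F)
      (closedBall (0 : F) ρ) (1 / 2) := by
    intro a ha b hb
    have := (convex_closedBall (0 : F) ρ).norm_image_sub_le_of_norm_hasFDerivWithin_le'
      hderiv (fun q hq => (hR q (by simpa using hq)).2) hb ha
    simpa using this
  let inv : (ContinuousLinearMap.id ℝ F).NonlinearRightInverse :=
    { toFun := id, nnnorm := 1, bound' := by simp, right_inv' := by intro; simp }
  have hsurj := happ.surjOn_closedBall_of_nonlinearRightInverse inv
    (by positivity : 0 ≤ ρ) subset_rfl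
  obtain ⟨q, hq, hqz⟩ := hsurj (show z ∈ _ by
    simp only [map_zero, add_zero, mem_closedBall, dist_eq_norm, hρ, inv]
    norm_num
    linarith)
  exact ⟨q, by simpa using hq, hqz⟩

/-- The adjoint form of 2-regularity yields operators `U`, `W` with `A W = 0` and
`A U + B W = 1`. -/
lemma exists_comp_eq_zero_and_add_eq_id {E F : Type*} [NormedAddCommGroup E]
    [InnerProductSpace ℝ E] [FiniteDimensional ℝ E] [NormedAddCommGroup F]
    [InnerProductSpace ℝ F] [FiniteDimensional ℝ F] [CompleteSpace E] [CompleteSpace F]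
    (A B : E →L[ℝ] F)
    (h : ∀ lam mu : F, ContinuousLinearMap.adjoint A lam = 0 →
      ContinuousLinearMap.adjoint B lam + ContinuousLinearMap.adjoint A mu = 0 → lam = 0) :
    ∃ U W : F →L[ℝ] E, (∀ q, A (W q) = 0) ∧ ∀ q, A (U q) + B (W q) = q := by
  let T : (E × LinearMap.ker (A : E →ₗ[ℝ] F)) →ₗ[ℝ] F :=
    (A : E →ₗ[ℝ] F).coprod ((B : E →ₗ[ℝ] F).comp (Submodule.subtype _))
  have hT : LinearMap.range T = ⊤ := by
    rw [← Submodule.orthogonal_eq_bot_iff, Submodule.eq_bot_iff]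
    intro lam hlam
    rw [Submodule.mem_orthogonal'] at hlam
    have hA : ContinuousLinearMap.adjoint A lam = 0 := by
      refine ext_inner_right ℝ fun u => ?_
      rw [ContinuousLinearMap.adjoint_inner_left, inner_zero_left]
      simpa [T] using hlam (T (u, 0)) ⟨_, rfl⟩
    have hB : ContinuousLinearMap.adjoint B lam ∈ (LinearMap.ker (A : E →ₗ[ℝ] F))ᗮ := by
      rw [Submodule.mem_orthogonal']
      intro w hw
      rw [ContinuousLinearMap.adjoint_inner_left]
      simpa [T] using hlam (T (0, ⟨w, hw⟩)) ⟨_, rfl⟩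
    have hB' : ContinuousLinearMap.adjoint B lam ∈
        LinearMap.range (ContinuousLinearMap.adjoint A : F →ₗ[ℝ] E) := by
      have := ContinuousLinearMap.orthogonal_ker A
      rw [this] at hB
      rwa [(Submodule.closed_of_finiteDimensional _).submodule_topologicalClosure_eq] at hB
    obtain ⟨mu, hmu⟩ := hB'
    refine h lam (-mu) hA ?_
    simp only [ContinuousLinearMap.coe_coe] at hmu
    rw [map_neg, hmu, add_neg_cancel]
  obtain ⟨S, hS⟩ := T.exists_rightInverse_of_surjective hT
  refine ⟨((LinearMap.fst ℝ _ _).comp S).toContinuousLinearMap,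
    ((Submodule.subtype _).comp ((LinearMap.snd ℝ _ _).comp S)).toContinuousLinearMap,
    fun q => ?_, fun q => ?_⟩
  · simp
  · simpa [T] using LinearMap.congr_fun hS q

/-- A point of a directional neighbourhood other than the apex lies close to a small positive
multiple of the direction. -/
lemma norm_sub_smul_le_of_mem_Vset {H : Type*} [NormedAddCommGroup H] [NormedSpace ℝ H]
    {eps delta : ℝ} {u v : H} (hv : v ≠ 0) (hu : u ≠ 0) (h : u ∈ Vset eps delta v) :
    ‖u‖ ≤ eps ∧ ‖u - (‖u‖ / ‖v‖) • v‖ ≤ delta * ‖u‖ := by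
  rw [Vset, if_neg hv] at h
  rcases h with h | ⟨h1, -, h2⟩
  · exact absurd h hu
  refine ⟨by simpa using h1, ?_⟩
  have hn : 0 < ‖u‖ := norm_pos_iff.2 hu
  have : u - (‖u‖ / ‖v‖) • v = ‖u‖ • (‖u‖⁻¹ • u - ‖v‖⁻¹ • v) := by
    rw [smul_sub, smul_smul, smul_smul, mul_inv_cancel₀ hn.ne', one_smul, div_eq_mul_inv]
  rw [this, norm_smul, norm_norm, mul_comm]
  gcongr

/-- If `A W = 0` and `A U + B W = 1`, then `t⁻¹ W + U` is an approximate right inverse of every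
operator close to `A + t B`. -/
lemma norm_comp_smul_add_sub_id_le {E F : Type*} [NormedAddCommGroup E] [NormedSpace ℝ E]
    [NormedAddCommGroup F] [NormedSpace ℝ F] {A B L : E →L[ℝ] F} {U W : F →L[ℝ] E}
    (hAW : ∀ q, A (W q) = 0) (hUW : ∀ q, A (U q) + B (W q) = q) {t c C : ℝ} (ht : 0 < t)
    (hc : 0 ≤ c) (hL : ‖L - A - t • B‖ ≤ c * t) (hC : ‖t⁻¹ • W + U‖ ≤ C / t) :
    ‖L.comp (t⁻¹ • W + U) - ContinuousLinearMap.id ℝ F‖ ≤ t * (‖B‖ * ‖U‖) + c * C := by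
  have key : L.comp (t⁻¹ • W + U) - ContinuousLinearMap.id ℝ F =
      t • B.comp U + (L - A - t • B).comp (t⁻¹ • W + U) := by
    ext q
    have h1 : t • B (t⁻¹ • W q) = B (W q) := by
      rw [map_smul, smul_smul, mul_inv_cancel₀ ht.ne', one_smul]
    have h2 : A (t⁻¹ • W q) = 0 := by rw [map_smul, hAW, smul_zero]
    have h3 := hUW q
    simp only [_root_.sub_apply, _root_.add_apply,
      ContinuousLinearMap.comp_apply, _root_.smul_apply,
      ContinuousLinearMap.id_apply, map_add, h1, h2]
    refine sub_eq_zero.1 (Eq.trans ?_ (sub_eq_zero.2 h3))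
    module
  rw [key]
  refine (norm_add_le _ _).trans (add_le_add ?_ ?_)
  · rw [norm_smul, Real.norm_of_nonneg ht.le]
    gcongr
    exact ContinuousLinearMap.opNorm_comp_le _ _
  · calc _ ≤ ‖L - A - t • B‖ * ‖t⁻¹ • W + U‖ := ContinuousLinearMap.opNorm_comp_le _ _
      _ ≤ (c * t) * (C / t) := by gcongr
      _ = c * C := by field_simp

/-- Points `y` near `yb` in direction `v` whose residual `z - g y` is of second order can be
corrected to an exact solution of `g x = z`, at a cost of order `‖z - g y‖ / t`. -/
lemma exists_eq_of_norm_sub_smul_le {E F : Type*} [NormedAddCommGroup E] [NormedSpace ℝ E]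
    [NormedAddCommGroup F] [NormedSpace ℝ F] [CompleteSpace F] {g : E → F} {yb v : E}
    (hdiff : ∀ᶠ y in 𝓝 yb, DifferentiableAt ℝ g y)
    (hdiff2 : DifferentiableAt ℝ (fderiv ℝ g) yb) {U W : F →L[ℝ] E}
    (hAW : ∀ q, fderiv ℝ g yb (W q) = 0)
    (hUW : ∀ q, fderiv ℝ g yb (U q) + fderiv ℝ (fderiv ℝ g) yb v (W q) = q)
    {N : ℝ} (hN0 : 0 < N) (hvN : ‖v‖ ≤ N) :
    ∃ τ > (0:ℝ), ∃ δ > (0:ℝ), ∃ C > (0:ℝ), ∀ (t : ℝ) (y : E) (z : F), 0 < t → t ≤ τ →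
      ‖y - yb‖ ≤ t * N → ‖y - yb - t • v‖ ≤ δ * (t * N) →
      ‖z - g y‖ ≤ δ * ‖y - yb‖ ^ 2 →
      ∃ x, g x = z ∧ dist y x ≤ C / t * (2 * ‖z - g y‖) := by
  set A := fderiv ℝ g yb
  set D := fderiv ℝ (fderiv ℝ g) yb
  set C := ‖W‖ + ‖U‖ + 1 with hC
  have hC0 : 0 < C := by positivity
  set K := N + 2 * C * N ^ 2 with hK
  have hK0 : 0 < K := by positivity
  set η := 1 / (6 * C * (N + K)) with hη
  have hη0 : 0 < η := by positivity
  obtain ⟨r, hr0, hr⟩ := Metric.eventually_nhds_iff.1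
    (hdiff.and (hdiff2.hasFDerivAt.isLittleO.def hη0))
  set δ := min 1 (1 / (6 * C * K * (‖D‖ + 1))) with hδ
  have hδ0 : 0 < δ := by positivity
  have hδ1 : δ ≤ 1 := min_le_left _ _
  have hδ2 : ‖D‖ * (δ * K) * C ≤ 1 / 6 := by
    have h1 : δ * (6 * C * K * (‖D‖ + 1)) ≤ 1 := by
      rw [← le_div_iff₀ (by positivity)]
      exact min_le_right _ _
    have h2 : 0 ≤ δ * C * K := by positivity
    nlinarith
  set τ := min 1 (min (1 / (6 * (‖D v‖ * ‖U‖ + 1))) (r / (2 * (N + K)))) with hτ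
  have hτ0 : 0 < τ := by positivity
  refine ⟨τ, hτ0, δ, hδ0, C, hC0, fun t y z ht0 htτ hyN hyt hz => ?_⟩
  have ht1 : t ≤ 1 := htτ.trans (min_le_left _ _)
  have ht2 : t * (‖D v‖ * ‖U‖) ≤ 1 / 6 := by
    have h1 : t ≤ 1 / (6 * (‖D v‖ * ‖U‖ + 1)) :=
      htτ.trans ((min_le_right _ _).trans (min_le_left _ _))
    rw [le_div_iff₀ (by positivity)] at h1
    linarith
  have ht3 : t * (N + K) < r := by
    have h1 : t ≤ r / (2 * (N + K)) :=
      htτ.trans ((min_le_right _ _).trans (min_le_right _ _))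
    rw [le_div_iff₀ (by positivity)] at h1
    linarith
  have hR : ‖t⁻¹ • W + U‖ ≤ C / t := by
    have h1 : ‖t⁻¹ • W + U‖ ≤ t⁻¹ * ‖W‖ + ‖U‖ := by
      refine (norm_add_le _ _).trans_eq ?_
      rw [norm_smul, norm_inv, Real.norm_of_nonneg ht0.le]
    refine h1.trans ?_
    rw [le_div_iff₀ ht0, add_mul, mul_right_comm, inv_mul_cancel₀ ht0.ne', hC]
    nlinarith [norm_nonneg U]
  have hRq : ∀ q : F, ‖q‖ ≤ 2 * ‖z - g y‖ →
      ‖(t⁻¹ • W + U) q‖ ≤ C / t * (2 * ‖z - g y‖) := fun q hq =>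
    (ContinuousLinearMap.le_opNorm _ _).trans (by gcongr)
  obtain ⟨q, hq, hgq⟩ := exists_eq_of_norm_fderiv_comp_sub_id_le (g := g) (y := y) (z := z)
    (t⁻¹ • W + U) (by
      intro q hq
      set x := y + (t⁻¹ • W + U) q with hx
      have hstep : ‖(t⁻¹ • W + U) q‖ ≤ δ * t * (2 * C * N ^ 2) := by
        calc _ ≤ C / t * (2 * ‖z - g y‖) := hRq q hq
          _ ≤ C / t * (2 * (δ * (t * N) ^ 2)) := by
            gcongr
            exact hz.trans (by gcongr)
          _ = _ := by field_simp
      have hxt : ‖x - yb - t • v‖ ≤ δ * K * t := by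
        have : x - yb - t • v = (y - yb - t • v) + (t⁻¹ • W + U) q := by rw [hx]; abel
        rw [this]
        refine (norm_add_le _ _).trans ((add_le_add hyt hstep).trans_eq ?_)
        rw [hK]; ring
      have hxb : ‖x - yb‖ ≤ t * (N + K) := by
        have : x - yb = t • v + (x - yb - t • v) := by abel
        rw [this]
        refine (norm_add_le _ _).trans ?_
        rw [norm_smul, Real.norm_of_nonneg ht0.le, mul_add]
        refine add_le_add (by gcongr) (hxt.trans ?_)
        rw [mul_comm]
        gcongr
        exact mul_le_of_le_one_left hK0.le hδ1
      obtain ⟨hd, he⟩ := hr (show dist x yb < r by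
        rw [dist_eq_norm]; exact hxb.trans_lt ht3)
      refine ⟨hd, ?_⟩
      have hL : ‖fderiv ℝ g x - A - t • D v‖ ≤ (‖D‖ * (δ * K) + η * (N + K)) * t := by
        have : fderiv ℝ g x - A - t • D v =
            (fderiv ℝ g x - fderiv ℝ g yb - D (x - yb)) + D (x - yb - t • v) := by
          rw [map_sub D (x - yb), map_smul]; abel
        rw [this]
        calc _ ≤ η * ‖x - yb‖ + ‖D‖ * ‖x - yb - t • v‖ :=
              (norm_add_le _ _).trans (add_le_add he (D.le_opNorm _))
          _ ≤ η * (t * (N + K)) + ‖D‖ * (δ * K * t) := by gcongr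
          _ = _ := by ring
      refine (norm_comp_smul_add_sub_id_le hAW hUW ht0 (by positivity) hL hR).trans ?_
      have hη1 : η * (N + K) * C = 1 / 6 := by rw [hη]; field_simp
      rw [add_mul, hη1]
      linarith)
  exact ⟨_, hgq, by rw [dist_self_add_right]; exact hRq q hq⟩

/-- Proposition 1, (b) ⇒ (c). -/
theorem statement_1 {m p : ℕ} (g : Em m → Em p) (yb v : Em m)
    (hg : TwiceDiffAt g yb) (hv : v ≠ 0)
    (hb : ∀ lam mu : Em p,
        adjA (fderiv ℝ g yb) lam = 0 ∧
        adjA (fderiv ℝ (fderiv ℝ g) yb v) lam + adjA (fderiv ℝ g yb) mu = 0 →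
        lam = 0) :
    ∃ eps > (0:ℝ), ∃ delta > (0:ℝ), ∃ κ > (0:ℝ), ∀ y : Em m, ∀ z : Em p,
      (y - yb, z - g yb) ∈ Vset eps delta (v, fderiv ℝ g yb v) → y ≠ yb →
      ‖z - g y‖ ≤ delta * ‖y - yb‖ ^ 2 →
      EMetric.infEdist y {x | g x = z} ≤ ENNReal.ofReal (κ / ‖y - yb‖ * ‖z - g y‖) := by
  obtain ⟨U, W, hAW, hUW⟩ := exists_comp_eq_zero_and_add_eq_id (fderiv ℝ g yb)
    (fderiv ℝ (fderiv ℝ g) yb v) (fun lam mu h1 h2 => hb lam mu ⟨h1, h2⟩)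
  set A := fderiv ℝ g yb
  have hV : ((v, A v) : Em m × Em p) ≠ 0 := fun h => hv (congrArg Prod.fst h)
  set N := ‖((v, A v) : Em m × Em p)‖ with hN
  have hN0 : 0 < N := norm_pos_iff.2 hV
  have hvN : ‖v‖ ≤ N := norm_fst_le ((v, A v) : Em m × Em p)
  obtain ⟨τ, hτ0, δ, hδ0, C, hC0, hcore⟩ :=
    exists_eq_of_norm_sub_smul_le hg.1 hg.2 hAW hUW hN0 hvN
  refine ⟨τ * N, by positivity, δ, hδ0, 2 * C * N, by positivity, fun y z hyz hy hz => ?_⟩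
  have hu : ((y - yb, z - g yb) : Em m × Em p) ≠ 0 :=
    fun h => hy (sub_eq_zero.1 (congrArg Prod.fst h))
  obtain ⟨hu1, hu2⟩ := norm_sub_smul_le_of_mem_Vset hV hu hyz
  set t := ‖((y - yb, z - g yb) : Em m × Em p)‖ / N with ht
  have ht0 : 0 < t := div_pos (norm_pos_iff.2 hu) hN0
  have htN : ‖((y - yb, z - g yb) : Em m × Em p)‖ = t * N := by rw [ht]; field_simp
  have htτ : t ≤ τ := by rw [ht, div_le_iff₀ hN0]; exact hu1
  have hyN : ‖y - yb‖ ≤ t * N :=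
    htN ▸ norm_fst_le ((y - yb, z - g yb) : Em m × Em p)
  have hyt : ‖y - yb - t • v‖ ≤ δ * (t * N) := by
    rw [htN] at hu2
    exact (norm_fst_le (((y - yb, z - g yb) : Em m × Em p) - t • (v, A v))).trans
      (by simpa [htN, hN0.ne'] using hu2)
  obtain ⟨x, hx, hyx⟩ := hcore t y z ht0 htτ hyN hyt hz
  refine (Metric.infEDist_le_edist_of_mem (show x ∈ {x | g x = z} from hx)).trans ?_
  rw [edist_dist]
  refine ENNReal.ofReal_le_ofReal (hyx.trans ?_)
  have hpos : 0 < ‖y - yb‖ := norm_pos_iff.2 (sub_ne_zero.2 hy)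
  have : C / t ≤ C * N / ‖y - yb‖ := by
    rw [div_le_div_iff₀ ht0 hpos, mul_assoc, mul_comm N]
    gcongr
  calc C / t * (2 * ‖z - g y‖) ≤ C * N / ‖y - yb‖ * (2 * ‖z - g y‖) := by gcongr
    _ = _ := by ring
end

section
/- Let g : ℝ^m → ℝ^p be twice Fréchet differentiable at ȳ ∈ ℝ^m and let v ∈ ℝ^m with v ≠ 0. Assume there are positive numbers ε, δ and κ such that for all (y,z) ∈ (ȳ, g(ȳ)) + V_{ε,δ}((v, ∇g(ȳ)v)) with y ≠ ȳ and ‖z − g(y)‖ ≤ δ‖y − ȳ‖², one has dist(y, g⁻¹(z)) ≤ (κ/‖y − ȳ‖)·‖z − g(y)‖. Then there are positive numbers ε̃, δ̃ and κ′ such that for all y ∈ ȳ + V_{ε̃,δ̃}(v), one has inf_{0≠λ∈ℝ^p} ‖∇g(y)ᵀλ‖/‖λ‖ ≥ ‖y − ȳ‖/κ′. -/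
open Set Filter Topology Metric RealInnerProductSpace

/-- Points that are close to `yb` in direction `v`, paired with values that are quadratically close
to their image, are close to `(yb, g yb)` in direction `(v, G v)`, where `G` is the derivative. -/
theorem HasFDerivAt.exists_mem_Vset_prod {E F : Type*} [NormedAddCommGroup E] [NormedSpace ℝ E]
    [NormedAddCommGroup F] [NormedSpace ℝ F] {g : E → F} {G : E →L[ℝ] F} {yb v : E}
    (hG : HasFDerivAt g G yb) (hv : v ≠ 0) {eps delta : ℝ} (heps : 0 < eps) (hdelta : 0 < delta) :
    ∃ e > (0 : ℝ), ∃ d > (0 : ℝ), ∀ y, y ≠ yb → y - yb ∈ Vset e d v →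
      ∀ z, ‖z - g y‖ ≤ ‖y - yb‖ ^ 2 → (y - yb, z - g yb) ∈ Vset eps delta (v, G v) := by
  have hvn : 0 < ‖v‖ := norm_pos_iff.2 hv
  have hw0 : ((v, G v) : E × F) ≠ 0 := fun h => hv (congrArg Prod.fst h)
  set w : E × F := ‖v‖⁻¹ • (v, G v) with hw
  have hwne : w ≠ 0 := smul_ne_zero (inv_ne_zero hvn.ne') hw0
  have hcont : ContinuousAt (fun u : E × F => ‖u‖⁻¹ • u) w :=
    (continuousAt_id.norm.inv₀ (norm_ne_zero_iff.2 hwne)).smul continuousAt_id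
  obtain ⟨θ, hθ, hclose⟩ := Metric.continuousAt_iff.1 hcont delta hdelta
  obtain ⟨ρ, hρ, hlin⟩ := Metric.eventually_nhds_iff.1
    ((hasFDerivAt_iff_isLittleO.1 hG).def (show 0 < θ / 4 by positivity))
  refine ⟨min (ρ / 2) (min (θ / 4) (eps / (‖w‖ + θ))), by positivity,
    θ / (4 * (‖G‖ + 1)), by positivity, fun y hy hyV z hz => ?_⟩
  have hh : y - yb ≠ 0 := sub_ne_zero.2 hy
  set h := y - yb
  set r := ‖h‖
  have hrpos : 0 < r := norm_pos_iff.2 hh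
  obtain ⟨hball, hdir⟩ : r ≤ min (ρ / 2) (min (θ / 4) (eps / (‖w‖ + θ))) ∧
      ‖r⁻¹ • h - ‖v‖⁻¹ • v‖ ≤ θ / (4 * (‖G‖ + 1)) := by
    rw [Vset, if_neg hv] at hyV
    rcases hyV with h0 | ⟨h1, -, h2⟩
    · exact absurd h0 hh
    · exact ⟨mem_closedBall_zero_iff.1 h1, h2⟩
  obtain ⟨hr1, hr2, hr3⟩ : r ≤ ρ / 2 ∧ r ≤ θ / 4 ∧ r ≤ eps / (‖w‖ + θ) := by
    simpa only [le_min_iff] using hball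
  have hGdir : ‖G (r⁻¹ • h - ‖v‖⁻¹ • v)‖ ≤ θ / 4 := by
    refine (G.le_opNorm_of_le hdir).trans ?_
    rw [mul_div_assoc', div_le_div_iff₀ (by positivity) (by positivity)]
    nlinarith [norm_nonneg G]
  have hdir' : ‖r⁻¹ • h - ‖v‖⁻¹ • v‖ ≤ θ / 4 := by
    refine hdir.trans (div_le_div_of_nonneg_left hθ.le (by positivity) ?_)
    linarith [norm_nonneg G]
  have hlin' : ‖g y - g yb - G h‖ ≤ θ / 4 * r :=
    hlin (by rw [dist_eq_norm]; linarith)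
  set u : E × F := r⁻¹ • (h, z - g yb) with hu
  have hsnd : r⁻¹ • (z - g yb) - ‖v‖⁻¹ • G v =
      r⁻¹ • (z - g y) + r⁻¹ • (g y - g yb - G h) + G (r⁻¹ • h - ‖v‖⁻¹ • v) := by
    simp only [map_sub, map_smul, smul_sub]
    abel
  have hsnd_le : ‖r⁻¹ • (z - g yb) - ‖v‖⁻¹ • G v‖ ≤ 3 * (θ / 4) := by
    have h1 : ‖r⁻¹ • (z - g y)‖ ≤ θ / 4 := by
      rw [norm_smul, norm_inv, Real.norm_of_nonneg hrpos.le, inv_mul_le_iff₀ hrpos]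
      nlinarith
    have h2 : ‖r⁻¹ • (g y - g yb - G h)‖ ≤ θ / 4 := by
      rw [norm_smul, norm_inv, Real.norm_of_nonneg hrpos.le, inv_mul_le_iff₀ hrpos]
      linarith
    rw [hsnd]
    linarith [norm_add₃_le (a := r⁻¹ • (z - g y)) (b := r⁻¹ • (g y - g yb - G h))
      (c := G (r⁻¹ • h - ‖v‖⁻¹ • v))]
  have huw : ‖u - w‖ < θ := by
    rw [Prod.norm_def]
    exact max_lt (lt_of_le_of_lt hdir' (by linarith)) (lt_of_le_of_lt hsnd_le (by linarith))
  have hpair : ((h, z - g yb) : E × F) = r • u := (smul_inv_smul₀ hrpos.ne' _).symm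
  have hpair_ne : ((h, z - g yb) : E × F) ≠ 0 := fun h0 => hh (congrArg Prod.fst h0)
  have hnormalize {c : ℝ} (hcpos : 0 < c) (x : E × F) : ‖c • x‖⁻¹ • c • x = ‖x‖⁻¹ • x := by
    rw [norm_smul, Real.norm_of_nonneg hcpos.le, mul_inv, smul_smul]
    congr 1
    field_simp
  rw [Vset, if_neg hw0]
  refine Or.inr ⟨?_, hpair_ne, ?_⟩
  · rw [mem_closedBall_zero_iff, hpair, norm_smul, Real.norm_of_nonneg hrpos.le]
    have hun : ‖u‖ ≤ ‖w‖ + θ := by linarith [norm_le_norm_add_norm_sub w u, norm_sub_rev u w]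
    calc r * ‖u‖ ≤ eps / (‖w‖ + θ) * (‖w‖ + θ) := by gcongr
      _ = eps := div_mul_cancel₀ _ (by positivity)
  · have := hclose (x := u) (by rwa [dist_eq_norm])
    rw [dist_eq_norm, hw, hnormalize (inv_pos.2 hvn), hu, hnormalize (inv_pos.2 hrpos)] at this
    exact this.le

/-- Uniform first-order expansion of a map around points near a point of twice differentiability. -/
theorem exists_norm_sub_sub_fderiv_le {E F : Type*} [NormedAddCommGroup E] [NormedSpace ℝ E]
    [NormedAddCommGroup F] [NormedSpace ℝ F] {g : E → F} {yb : E}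
    (hd : ∀ᶠ y in 𝓝 yb, DifferentiableAt ℝ g y) (hd2 : DifferentiableAt ℝ (fderiv ℝ g) yb)
    {η : ℝ} (hη : 0 < η) :
    ∃ ρ > (0 : ℝ), ∀ y x, ‖y - yb‖ ≤ ρ → ‖x - y‖ ≤ 2 * ‖y - yb‖ →
      ‖g x - g y - fderiv ℝ g y (x - y)‖ ≤
        (‖fderiv ℝ (fderiv ℝ g) yb‖ * ‖x - y‖ + η * ‖y - yb‖) * ‖x - y‖ := by
  set B := fderiv ℝ (fderiv ℝ g) yb
  obtain ⟨ρ, hρ, hball⟩ := Metric.eventually_nhds_iff.1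
    (hd.and ((hasFDerivAt_iff_isLittleO.1 hd2.hasFDerivAt).def (show 0 < η / 4 by positivity)))
  refine ⟨ρ / 4, by positivity, fun y x hy hx => ?_⟩
  have hnear {a : E} (ha : a ∈ closedBall y ‖x - y‖) : ‖a - yb‖ ≤ 3 * ‖y - yb‖ := by
    have := norm_add_le (a - y) (y - yb)
    rw [sub_add_sub_cancel] at this
    linarith [mem_closedBall_iff_norm.1 ha]
  have hdist {a : E} (ha : a ∈ closedBall y ‖x - y‖) : dist a yb < ρ := by
    rw [dist_eq_norm]
    linarith [hnear ha]
  have hyc : y ∈ closedBall y ‖x - y‖ := mem_closedBall_self (norm_nonneg _)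
  refine (convex_closedBall y ‖x - y‖).norm_image_sub_le_of_norm_hasFDerivWithin_le'
    (f' := fderiv ℝ g) (fun a ha => (hball (hdist ha)).1.hasFDerivAt.hasFDerivWithinAt)
    (fun a ha => ?_) hyc (by rw [mem_closedBall, dist_eq_norm])
  have h1 : ‖fderiv ℝ g a - fderiv ℝ g yb - B (a - yb)‖ ≤ η / 4 * ‖a - yb‖ := (hball (hdist ha)).2
  have h2 : ‖fderiv ℝ g y - fderiv ℝ g yb - B (y - yb)‖ ≤ η / 4 * ‖y - yb‖ :=
    (hball (hdist hyc)).2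
  have h3 : ‖B (a - y)‖ ≤ ‖B‖ * ‖x - y‖ := B.le_opNorm_of_le (mem_closedBall_iff_norm.1 ha)
  have hsplit : fderiv ℝ g a - fderiv ℝ g y = B (a - y) +
      (fderiv ℝ g a - fderiv ℝ g yb - B (a - yb)) -
      (fderiv ℝ g y - fderiv ℝ g yb - B (y - yb)) := by
    simp only [map_sub]
    abel
  rw [hsplit]
  refine (norm_sub_le _ _).trans ?_
  have h4 := norm_add_le (B (a - y)) (fderiv ℝ g a - fderiv ℝ g yb - B (a - yb))
  nlinarith [hnear ha]

/-- Proposition 1, (c) ⇒ (d). -/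
theorem statement_2 {m p : ℕ} (g : Em m → Em p) (yb v : Em m)
    (hg : TwiceDiffAt g yb) (hv : v ≠ 0)
    (hc : ∃ eps > (0:ℝ), ∃ delta > (0:ℝ), ∃ κ > (0:ℝ), ∀ y : Em m, ∀ z : Em p,
      (y - yb, z - g yb) ∈ Vset eps delta (v, fderiv ℝ g yb v) → y ≠ yb →
      ‖z - g y‖ ≤ delta * ‖y - yb‖ ^ 2 →
      EMetric.infEdist y {x | g x = z} ≤ ENNReal.ofReal (κ / ‖y - yb‖ * ‖z - g y‖)) :
    ∃ eps > (0:ℝ), ∃ delta > (0:ℝ), ∃ κ' > (0:ℝ), ∀ y : Em m,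
      y - yb ∈ Vset eps delta v →
      ∀ lam : Em p, lam ≠ 0 → ‖y - yb‖ / κ' ≤ ‖adjA (fderiv ℝ g y) lam‖ / ‖lam‖ := by
  obtain ⟨eps, heps, delta, hdelta, κ, hκ, hreg⟩ := hc
  obtain ⟨e, he, d, hd, hV⟩ :=
    hg.1.self_of_nhds.hasFDerivAt.exists_mem_Vset_prod hv heps hdelta
  obtain ⟨ρ, hρ, hexp⟩ :=
    exists_norm_sub_sub_fderiv_le hg.1 hg.2 (show (0 : ℝ) < 1 / (8 * κ) by positivity)
  set β := ‖fderiv ℝ (fderiv ℝ g) yb‖ with hβ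
  have hβ0 : 0 ≤ β := hβ ▸ norm_nonneg (fderiv ℝ (fderiv ℝ g) yb)
  obtain ⟨t, ht, ht1, htd, htκ, htβ⟩ : ∃ t : ℝ, 0 < t ∧ t ≤ 1 ∧ t ≤ delta ∧ t * κ ≤ 1 ∧
      16 * κ ^ 2 * (β + 1) * t ≤ 1 := by
    refine ⟨min (min 1 delta) (min (1 / κ) (1 / (16 * κ ^ 2 * (β + 1)))), by positivity,
      (min_le_left _ _).trans (min_le_left _ _), (min_le_left _ _).trans (min_le_right _ _), ?_, ?_⟩
    · rw [← le_div_iff₀ hκ]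
      exact (min_le_right _ _).trans (min_le_left _ _)
    · rw [mul_comm, ← le_div_iff₀ (by positivity)]
      exact (min_le_right _ _).trans (min_le_right _ _)
  refine ⟨min e ρ, lt_min he hρ, d, hd, 4 * κ, by positivity, fun y hyV lam hlam => ?_⟩
  have hlpos : 0 < ‖lam‖ := norm_pos_iff.2 hlam
  rcases eq_or_ne y yb with rfl | hy
  · rw [sub_self, norm_zero, zero_div]
    positivity
  have hr : 0 < ‖y - yb‖ := norm_pos_iff.2 (sub_ne_zero.2 hy)
  obtain ⟨hyV', hyρ⟩ : y - yb ∈ Vset e d v ∧ ‖y - yb‖ ≤ ρ := by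
    rw [Vset, if_neg hv] at hyV ⊢
    rcases hyV with h0 | ⟨h1, h2, h3⟩
    · exact absurd h0 (sub_ne_zero.2 hy)
    · rw [mem_closedBall_zero_iff, le_min_iff] at h1
      exact ⟨Or.inr ⟨mem_closedBall_zero_iff.2 h1.1, h2, h3⟩, h1.2⟩
  set r := ‖y - yb‖
  set c := t * r ^ 2 with hcdef
  have hcpos : 0 < c := by positivity
  set z := g y + (c / ‖lam‖) • lam with hzdef
  have hzsub : z - g y = (c / ‖lam‖) • lam := add_sub_cancel_left _ _
  have hz : ‖z - g y‖ = c := by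
    rw [hzsub, norm_smul, Real.norm_of_nonneg (by positivity), div_mul_cancel₀ _ hlpos.ne']
  have hinf := hreg y z
    (hV y hy hyV' z (by rw [hz]; exact mul_le_of_le_one_left (by positivity) ht1)) hy
    (by rw [hz]; exact mul_le_mul_of_nonneg_right htd (by positivity))
  have hlt : ENNReal.ofReal (κ / r * ‖z - g y‖) < ENNReal.ofReal (2 * κ * t * r) := by
    rw [ENNReal.ofReal_lt_ofReal_iff (by positivity), hz, hcdef]
    have : κ / r * (t * r ^ 2) = κ * t * r := by field_simp
    have : 0 < κ * t * r := by positivity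
    linarith
  obtain ⟨x, hxz, hxy⟩ := Metric.infEDist_lt_iff.1 (hinf.trans_lt hlt)
  replace hxz : g x = z := hxz
  have hx : ‖x - y‖ < 2 * κ * t * r := by
    rwa [edist_dist, ENNReal.ofReal_lt_ofReal_iff (by positivity), dist_comm, dist_eq_norm] at hxy
  have hexpx := hexp y x hyρ (by nlinarith)
  set A := fderiv ℝ g y
  have hadj : ⟪lam, A (x - y)⟫ ≤ ‖adjA A lam‖ * ‖x - y‖ := by
    rw [← ContinuousLinearMap.adjoint_inner_left]
    exact real_inner_le_norm _ _
  have hrem := real_inner_le_norm lam (g x - g y - A (x - y))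
  have hinner : ⟪lam, g x - g y⟫ = c * ‖lam‖ := by
    rw [hxz, hzsub, real_inner_smul_right, real_inner_self_eq_norm_sq]
    field_simp
  rw [inner_sub_right, hinner] at hrem
  set a := ‖adjA A lam‖
  have ha0 : 0 ≤ a := norm_nonneg _
  have hcoef : β * ‖x - y‖ + 1 / (8 * κ) * r ≤ 1 / (4 * κ) * r := by
    have h1 : β * ‖x - y‖ ≤ β * (2 * κ * t * r) := by gcongr
    have h2 : β * (2 * κ * t) ≤ 1 / (8 * κ) := by
      rw [le_div_iff₀ (by positivity)]
      have : 0 < κ ^ 2 * t := by positivity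
      nlinarith
    have h3 : β * (2 * κ * t) * r ≤ 1 / (8 * κ) * r := by gcongr
    have h4 : 1 / (4 * κ) * r = 1 / (8 * κ) * r + 1 / (8 * κ) * r := by field_simp; norm_num
    linarith
  have hbound : c * ‖lam‖ ≤ (a + ‖lam‖ * (1 / (4 * κ) * r)) * (2 * κ * t * r) := by
    have h1 : ‖g x - g y - A (x - y)‖ ≤ 1 / (4 * κ) * r * ‖x - y‖ := hexpx.trans (by gcongr)
    calc c * ‖lam‖ ≤ a * ‖x - y‖ + ‖lam‖ * ‖g x - g y - A (x - y)‖ := by linarith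
      _ ≤ a * ‖x - y‖ + ‖lam‖ * (1 / (4 * κ) * r * ‖x - y‖) := by gcongr
      _ = (a + ‖lam‖ * (1 / (4 * κ) * r)) * ‖x - y‖ := by ring
      _ ≤ _ := by gcongr
  have hfinal : r * ‖lam‖ ≤ 4 * κ * a := by
    have h1 : (a + ‖lam‖ * (1 / (4 * κ) * r)) * (2 * κ * t * r) =
        (t * r) * (2 * κ * a + r * ‖lam‖ / 2) := by
      field_simp
      ring
    have h2 : c * ‖lam‖ = (t * r) * (r * ‖lam‖) := by rw [hcdef]; ring
    rw [h1, h2] at hbound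
    linarith [le_of_mul_le_mul_left hbound (by positivity)]
  rw [div_le_div_iff₀ (by positivity) hlpos]
  linarith
end

section
/- Let g : ℝ^m → ℝ^p be twice Fréchet differentiable at ȳ ∈ ℝ^m and let v ∈ ℝ^m with v ≠ 0. Assume there are positive numbers ε̃, δ̃ and κ′ such that for all y ∈ ȳ + V_{ε̃,δ̃}(v), one has inf_{0≠λ∈ℝ^p} ‖∇g(y)ᵀλ‖/‖λ‖ ≥ ‖y − ȳ‖/κ′. Then the implication [∇g(ȳ)ᵀλ = 0 and (vᵀ∇²g(ȳ))ᵀλ + ∇g(ȳ)ᵀμ = 0] ⟹ λ = 0 holds for all λ, μ ∈ ℝ^p. -/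
open Set Filter Topology Metric RealInnerProductSpace

/-- Taking adjoints commutes with differentiating a curve of operators. -/
theorem HasDerivAt.clm_adjoint {E F : Type*} [NormedAddCommGroup E] [InnerProductSpace ℝ E]
    [CompleteSpace E] [NormedAddCommGroup F] [InnerProductSpace ℝ F] [CompleteSpace F]
    {A : ℝ → E →L[ℝ] F} {A' : E →L[ℝ] F} {t : ℝ} (h : HasDerivAt A A' t) :
    HasDerivAt (fun s => ContinuousLinearMap.adjoint (A s))
      (ContinuousLinearMap.adjoint A') t := by
  rw [hasDerivAt_iff_tendsto_slope] at h ⊢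
  refine ((ContinuousLinearMap.adjoint.continuous.tendsto A').comp h).congr fun s => ?_
  simp [slope_def_module]

/-- Small positive multiples of `v` belong to the directional neighborhoods of `v`. -/
theorem eventually_smul_mem_Vset {H : Type*} [NormedAddCommGroup H] [NormedSpace ℝ H]
    {eps delta : ℝ} (heps : 0 < eps) (hdelta : 0 < delta) {v : H} (hv : v ≠ 0) :
    ∀ᶠ t : ℝ in 𝓝[>] 0, t • v ∈ Vset eps delta v := by
  have hcont : Tendsto (fun t : ℝ => t • v) (𝓝[>] 0) (𝓝 0) := by
    have : Continuous fun t : ℝ => t • v := by fun_prop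
    simpa using (this.tendsto 0).mono_left nhdsWithin_le_nhds
  filter_upwards [self_mem_nhdsWithin, hcont (Metric.closedBall_mem_nhds 0 heps)] with t ht hball
  have ht : 0 < t := ht
  rw [Vset, if_neg hv]
  refine Or.inr ⟨hball, smul_ne_zero ht.ne' hv, ?_⟩
  have hdir : ‖t • v‖⁻¹ • t • v = ‖v‖⁻¹ • v := by
    rw [norm_smul, Real.norm_of_nonneg ht.le, smul_smul]
    congr 1
    field_simp
  simpa [hdir] using hdelta.le

/-- Proposition 1, (d) ⇒ (b). -/
theorem statement_3 {m p : ℕ} (g : Em m → Em p) (yb v : Em m)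
    (hg : TwiceDiffAt g yb) (hv : v ≠ 0)
    (hd : ∃ eps > (0:ℝ), ∃ delta > (0:ℝ), ∃ κ' > (0:ℝ), ∀ y : Em m,
      y - yb ∈ Vset eps delta v →
      ∀ lam : Em p, lam ≠ 0 → ‖y - yb‖ / κ' ≤ ‖adjA (fderiv ℝ g y) lam‖ / ‖lam‖) :
    ∀ lam mu : Em p,
      adjA (fderiv ℝ g yb) lam = 0 ∧
      adjA (fderiv ℝ (fderiv ℝ g) yb v) lam + adjA (fderiv ℝ g yb) mu = 0 →
      lam = 0 := by
  rintro lam mu ⟨hlam, hmu⟩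
  obtain ⟨eps, heps, delta, hdelta, κ, hκ, hd⟩ := hd
  let h : ℝ → Em m := fun t => adjA (fderiv ℝ g (yb + t • v)) (lam + t • mu)
  have hline : HasDerivAt (fun t : ℝ => yb + t • v) v 0 := by
    simpa using ((hasDerivAt_id (0 : ℝ)).smul_const v).const_add yb
  have hmult : HasDerivAt (fun t : ℝ => lam + t • mu) mu 0 := by
    simpa using ((hasDerivAt_id (0 : ℝ)).smul_const mu).const_add lam
  have hjac : HasDerivAt (fun t : ℝ => fderiv ℝ g (yb + t • v))
      (fderiv ℝ (fderiv ℝ g) yb v) 0 := by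
    have hF : HasFDerivAt (fderiv ℝ g) (fderiv ℝ (fderiv ℝ g) yb) (yb + (0 : ℝ) • v) := by
      simpa using hg.2.hasFDerivAt
    exact hF.comp_hasDerivAt 0 hline
  have hderiv : HasDerivAt h 0 0 := by
    have := hjac.clm_adjoint.clm_apply hmult
    simp only [zero_smul, add_zero] at this
    exact hmu ▸ this
  have h_zero : h 0 = 0 := by simpa [h] using hlam
  have hslope : Tendsto (fun t => ‖t⁻¹ • h t‖) (𝓝[>] 0) (𝓝 0) := by
    have hsub : Ioi (0 : ℝ) ⊆ {0}ᶜ := fun t ht => ne_of_gt ht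
    have := (hasDerivAt_iff_tendsto_slope.1 hderiv).mono_left (nhdsWithin_mono 0 hsub)
    simpa [slope_fun_def, h_zero] using this.norm
  have hbound : Tendsto (fun t : ℝ => ‖v‖ / κ * ‖lam + t • mu‖) (𝓝[>] 0)
      (𝓝 (‖v‖ / κ * ‖lam‖)) := by
    have : Continuous fun t : ℝ => ‖v‖ / κ * ‖lam + t • mu‖ := by fun_prop
    simpa using (this.tendsto 0).mono_left nhdsWithin_le_nhds
  have hle : ‖v‖ / κ * ‖lam‖ ≤ 0 := by
    refine le_of_tendsto_of_tendsto hbound hslope ?_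
    filter_upwards [self_mem_nhdsWithin, eventually_smul_mem_Vset heps hdelta hv] with t ht hmem
    have ht : 0 < t := ht
    by_cases hz : lam + t • mu = 0
    · simp [hz]
    have key := hd (yb + t • v) (by simpa using hmem) _ hz
    rw [le_div_iff₀ (norm_pos_iff.2 hz), add_sub_cancel_left, norm_smul,
      Real.norm_of_nonneg ht.le] at key
    rw [norm_smul, norm_inv, Real.norm_of_nonneg ht.le, ← div_eq_inv_mul, le_div_iff₀ ht]
    calc ‖v‖ / κ * ‖lam + t • mu‖ * t = t * ‖v‖ / κ * ‖lam + t • mu‖ := by ring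
      _ ≤ ‖h t‖ := key
  have hpos : 0 < ‖v‖ / κ := div_pos (norm_pos_iff.2 hv) hκ
  exact norm_le_zero_iff.1 (nonpos_of_mul_nonpos_right hle hpos)
end

section
/- Let g : ℝ^m → ℝ^p be twice Fréchet differentiable at ȳ ∈ ℝ^m with g(ȳ) = 0, let I ⊂ {1,…,p} and let v ∈ ℝ^m satisfy ∇g(ȳ)v = 0. If there exist sequences t_k ↓ 0 and v_k → v such that lim_{k→∞} t_k⁻² g_i(ȳ + t_k v_k) = 0 for every i ∈ I and limsup_{k→∞} t_k⁻² g_i(ȳ + t_k v_k) ≤ 0 for every i ∈ {1,…,p}∖I, then there exists z̄ ∈ ℝ^m with ∇g_i(ȳ)z̄ + vᵀ∇²g_i(ȳ)v = 0 for every i ∈ I and ∇g_i(ȳ)z̄ + vᵀ∇²g_i(ȳ)v ≤ 0 for every i ∈ {1,…,p}∖I. -/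
open Set Filter Topology Metric RealInnerProductSpace

/-- A finite system of linear equalities and inequalities in a finite-dimensional space that is
solvable for right-hand sides `b k` is solvable for every limit of the `b k`. -/
theorem exists_linear_system_of_tendsto {E ι : Type*} [NormedAddCommGroup E]
    [InnerProductSpace ℝ E] [FiniteDimensional ℝ E] [Finite ι] (L : ι → E →L[ℝ] ℝ) (I : Set ι)
    (b : ℕ → ι → ℝ) (c : ι → ℝ) (hb : ∀ i, Tendsto (fun k => b k i) atTop (𝓝 (c i)))
    (hfeas : ∀ k, ∃ z, (∀ i ∈ I, L i z = b k i) ∧ ∀ i ∉ I, L i z ≤ b k i) :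
    ∃ z, (∀ i ∈ I, L i z = c i) ∧ ∀ i ∉ I, L i z ≤ c i := by
  have hmin : ∀ k, ∃ z, ((∀ i ∈ I, L i z = b k i) ∧ ∀ i ∉ I, L i z ≤ b k i) ∧
      ∀ y, ((∀ i ∈ I, L i y = b k i) ∧ ∀ i ∉ I, L i y ≤ b k i) → ‖z‖ ≤ ‖y‖ := by
    intro k
    have hcl : IsClosed {z : E | (∀ i ∈ I, L i z = b k i) ∧ ∀ i ∉ I, L i z ≤ b k i} := by
      simp only [Set.ofPred_and, Set.ofPred_forall]
      exact (isClosed_biInter fun i _ => isClosed_eq (L i).continuous continuous_const).inter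
        (isClosed_biInter fun i _ => isClosed_le (L i).continuous continuous_const)
    obtain ⟨z, hz, hzd⟩ := hcl.exists_infDist_eq_dist (hfeas k) 0
    refine ⟨z, hz, fun y hy => ?_⟩
    have := Metric.infDist_le_dist_of_mem (x := (0 : E))
      (s := {z : E | (∀ i ∈ I, L i z = b k i) ∧ ∀ i ∉ I, L i z ≤ b k i}) hy
    rwa [hzd, dist_zero_left, dist_zero_left] at this
  choose z hz hzmin using hmin
  by_cases hbd : Tendsto (fun k => ‖z k‖) atTop atTop
  · exfalso
    have hball : ∀ k, ‖z k‖⁻¹ • z k ∈ Metric.closedBall (0 : E) 1 := by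
      intro k
      rw [mem_closedBall_zero_iff, norm_smul, norm_inv, norm_norm]
      exact inv_mul_le_one
    obtain ⟨d, -, φ, hφ, hd⟩ := (isCompact_closedBall (0 : E) 1).tendsto_subseq hball
    have hn := hbd.comp hφ.tendsto_atTop
    have hpos : ∀ᶠ k in atTop, 0 < ‖z (φ k)‖ := hn.eventually_gt_atTop 0
    have hd1 : ‖d‖ = 1 := by
      refine tendsto_nhds_unique hd.norm (tendsto_const_nhds.congr' ?_)
      filter_upwards [hpos] with k hk
      simp only [Function.comp_apply, norm_smul, norm_inv, norm_norm]
      rw [inv_mul_cancel₀ hk.ne']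
    have hinv : Tendsto (fun k => ‖z (φ k)‖⁻¹) atTop (𝓝 0) := tendsto_inv_atTop_zero.comp hn
    have hLd : ∀ i, Tendsto (fun k => ‖z (φ k)‖⁻¹ * L i (z (φ k))) atTop (𝓝 (L i d)) := by
      intro i
      simpa [Function.comp_def] using ((L i).continuous.tendsto d).comp hd
    have hbφ : ∀ i, Tendsto (fun k => b (φ k) i) atTop (𝓝 (c i)) :=
      fun i => (hb i).comp hφ.tendsto_atTop
    have hb0 : ∀ i, Tendsto (fun k => ‖z (φ k)‖⁻¹ * b (φ k) i) atTop (𝓝 0) := by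
      intro i
      simpa using hinv.mul (hbφ i)
    have heq : ∀ i ∈ I, L i d = 0 := by
      intro i hi
      refine tendsto_nhds_unique (hLd i) ((hb0 i).congr fun k => ?_)
      rw [(hz (φ k)).1 i hi]
    have hle : ∀ i ∉ I, L i d ≤ 0 := by
      intro i hi
      refine le_of_tendsto_of_tendsto' (hLd i) (hb0 i) fun k => ?_
      exact mul_le_mul_of_nonneg_left ((hz (φ k)).2 i hi) (by positivity)
    have hshift : ∀ i, ∀ᶠ k in atTop, i ∉ I → L i (z (φ k) - d) ≤ b (φ k) i := by
      intro i
      by_cases hi : i ∈ I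
      · exact Eventually.of_forall fun _ h => absurd hi h
      rcases (hle i hi).eq_or_lt with h0 | hneg
      · refine Eventually.of_forall fun k _ => ?_
        rw [map_sub, h0, sub_zero]
        exact (hz (φ k)).2 i hi
      · have hlim : Tendsto (fun k => ‖z (φ k)‖⁻¹ * L i (z (φ k)) - ‖z (φ k)‖⁻¹ * L i d
            - ‖z (φ k)‖⁻¹ * b (φ k) i) atTop (𝓝 (L i d)) := by
          simpa using ((hLd i).sub (hinv.mul_const (L i d))).sub (hb0 i)
        filter_upwards [hlim.eventually_lt_const hneg, hpos] with k hk hk' _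
        rw [map_sub]
        have : 0 < ‖z (φ k)‖⁻¹ := inv_pos.2 hk'
        by_contra! hcon
        nlinarith
    have hnorm : ∀ᶠ k in atTop, ‖z (φ k) - d‖ < ‖z (φ k)‖ := by
      have hin : Tendsto (fun k => ‖z (φ k)‖⁻¹ * ⟪z (φ k), d⟫) atTop (𝓝 1) := by
        have := hd.inner (𝕜 := ℝ) (tendsto_const_nhds (x := d))
        simpa [Function.comp_def, inner_smul_left, hd1] using this
      filter_upwards [hin.eventually_const_lt (show (1 / 2 : ℝ) < 1 by norm_num),
        hn.eventually_gt_atTop 1] with k hk hk1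
      simp only [Function.comp_apply] at hk1
      have hin' : 1 / 2 * ‖z (φ k)‖ < ⟪z (φ k), d⟫ := by
        rw [inv_mul_eq_div, lt_div_iff₀ (by linarith)] at hk
        exact hk
      refine lt_of_pow_lt_pow_left₀ 2 (norm_nonneg _) ?_
      rw [norm_sub_sq_real, hd1]
      linarith
    obtain ⟨k, hk, hkn⟩ := ((eventually_all.2 hshift).and hnorm).exists
    refine absurd (hzmin (φ k) (z (φ k) - d) ⟨fun i hi => ?_, hk⟩) (not_le.2 hkn)
    rw [map_sub, heq i hi, sub_zero, (hz (φ k)).1 i hi]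
  · rw [Filter.tendsto_atTop] at hbd
    push Not at hbd
    obtain ⟨R, hR⟩ := hbd
    have hfr : ∃ᶠ k in atTop, z k ∈ Metric.closedBall (0 : E) R :=
      hR.mono fun k hk => mem_closedBall_zero_iff.2 hk.le
    obtain ⟨a, -, φ, hφ, ha⟩ :=
      tendsto_subseq_of_frequently_bounded Metric.isBounded_closedBall hfr
    have hLa : ∀ i, Tendsto (fun k => L i (z (φ k))) atTop (𝓝 (L i a)) :=
      fun i => ((L i).continuous.tendsto a).comp ha
    have hbφ : ∀ i, Tendsto (fun k => b (φ k) i) atTop (𝓝 (c i)) :=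
      fun i => (hb i).comp hφ.tendsto_atTop
    exact ⟨a, fun i hi => tendsto_nhds_unique (hLa i)
        ((hbφ i).congr fun k => ((hz (φ k)).1 i hi).symm),
      fun i hi => le_of_tendsto_of_tendsto' (hLa i) (hbφ i) fun k => (hz (φ k)).2 i hi⟩

/-- Second-order Taylor expansion with Peano remainder. -/
theorem taylor_two_isLittleO {E F : Type*} [NormedAddCommGroup E] [NormedSpace ℝ E]
    [NormedAddCommGroup F] [NormedSpace ℝ F] {f : E → F} {x : E}
    (hf : ∀ᶠ y in 𝓝 x, DifferentiableAt ℝ f y) (hf' : DifferentiableAt ℝ (fderiv ℝ f) x) :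
    (fun w => f (x + w) - f x - fderiv ℝ f x w - (1 / 2 : ℝ) • fderiv ℝ (fderiv ℝ f) x w w)
      =o[𝓝 0] fun w => ‖w‖ ^ 2 := by
  set H := fderiv ℝ (fderiv ℝ f) x with hH
  have hsymm : ∀ u w, H u w = H w u :=
    second_derivative_symmetric_of_eventually (hf.mono fun y hy => hy.hasFDerivAt)
      hf'.hasFDerivAt
  have hlit := (hasFDerivAt_iff_isLittleO_nhds_zero.1 hf'.hasFDerivAt)
  rw [Asymptotics.isLittleO_iff] at hlit ⊢
  intro ε hε
  have hf0 : ∀ᶠ w in 𝓝 (0 : E), DifferentiableAt ℝ f (x + w) := by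
    have : Tendsto (fun w : E => x + w) (𝓝 0) (𝓝 x) := by
      simpa using (tendsto_const_nhds (x := x)).add (tendsto_id (α := E) (x := 𝓝 0))
    exact this.eventually hf
  obtain ⟨r, hr, hball⟩ := Metric.eventually_nhds_iff_ball.1 (hf0.and (hlit hε))
  filter_upwards [Metric.ball_mem_nhds (0 : E) hr] with w hw
  have hderiv : ∀ y ∈ Metric.closedBall (0 : E) ‖w‖, HasFDerivWithinAt
      (fun w => f (x + w) - f x - fderiv ℝ f x w - (1 / 2 : ℝ) • H w w)
      (fderiv ℝ f (x + y) - fderiv ℝ f x - H y) (Metric.closedBall (0 : E) ‖w‖) y := by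
    intro y hy
    have hyr : y ∈ Metric.ball (0 : E) r := by
      rw [mem_ball_zero_iff] at hw ⊢
      exact (mem_closedBall_zero_iff.1 hy).trans_lt hw
    have h1 : HasFDerivAt (fun w => f (x + w)) (fderiv ℝ f (x + y)) y :=
      (hasFDerivAt_comp_add_left x).2 (hball y hyr).1.hasFDerivAt
    have h2 : HasFDerivAt (fun w => H w w) (H y + H.flip y) y := by
      refine (H.hasFDerivAt.clm_apply (hasFDerivAt_id y)).congr_fderiv ?_
      ext u
      simp
    refine HasFDerivAt.hasFDerivWithinAt ((((h1.sub_const (f x)).sub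
      (fderiv ℝ f x).hasFDerivAt).sub (h2.const_smul (1 / 2 : ℝ))).congr_fderiv ?_)
    ext u
    have := hsymm u y
    simp only [sub_apply, smul_apply, add_apply, ContinuousLinearMap.flip_apply, this, ← two_smul ℝ, smul_smul]
    norm_num
  have hbound : ∀ y ∈ Metric.closedBall (0 : E) ‖w‖,
      ‖fderiv ℝ f (x + y) - fderiv ℝ f x - H y‖ ≤ ε * ‖w‖ := by
    intro y hy
    have hyw := mem_closedBall_zero_iff.1 hy
    have hyr : y ∈ Metric.ball (0 : E) r := by
      rw [mem_ball_zero_iff] at hw ⊢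
      exact hyw.trans_lt hw
    exact (hball y hyr).2.trans (by gcongr)
  have := (convex_closedBall (0 : E) ‖w‖).norm_image_sub_le_of_norm_hasFDerivWithin_le hderiv
    hbound (mem_closedBall_self (norm_nonneg w)) (mem_closedBall_zero_iff.2 le_rfl)
  simpa [pow_two, mul_assoc] using this

/-- Second-order difference quotients along the sequence `x + t k • u k`. -/
theorem tendsto_second_order_quotient {E F : Type*} [NormedAddCommGroup E] [NormedSpace ℝ E]
    [NormedAddCommGroup F] [NormedSpace ℝ F] {f : E → F} {x v : E}
    (hf : ∀ᶠ y in 𝓝 x, DifferentiableAt ℝ f y) (hf' : DifferentiableAt ℝ (fderiv ℝ f) x)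
    {t : ℕ → ℝ} {u : ℕ → E} (ht : ∀ k, 0 < t k) (ht0 : Tendsto t atTop (𝓝 0))
    (hu : Tendsto u atTop (𝓝 v)) :
    Tendsto (fun k => ((t k)⁻¹ ^ 2) • (f (x + t k • u k) - f x) - (t k)⁻¹ • fderiv ℝ f x (u k))
      atTop (𝓝 ((1 / 2 : ℝ) • fderiv ℝ (fderiv ℝ f) x v v)) := by
  have hw : Tendsto (fun k => t k • u k) atTop (𝓝 0) := by simpa using ht0.smul hu
  have ho := (taylor_two_isLittleO hf hf').comp_tendsto hw
  have hO : (fun k => ‖t k • u k‖ ^ 2) =O[atTop] fun k => t k ^ 2 := by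
    have h1 : (fun k => ‖u k‖ ^ 2) =O[atTop] fun _ => (1 : ℝ) :=
      (hu.norm.pow 2).isBigO_one ℝ
    simpa [norm_smul, mul_pow] using (Asymptotics.isBigO_refl (fun k => t k ^ 2) atTop).mul h1
  have hrem := (ho.trans_isBigO hO).tendsto_inv_smul_nhds_zero
  have hH : Tendsto (fun k => (1 / 2 : ℝ) • fderiv ℝ (fderiv ℝ f) x (u k) (u k)) atTop
      (𝓝 ((1 / 2 : ℝ) • fderiv ℝ (fderiv ℝ f) x v v)) := by
    have hc : Continuous fun w => (1 / 2 : ℝ) • fderiv ℝ (fderiv ℝ f) x w w := by fun_prop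
    exact (hc.tendsto v).comp hu
  have hsum := hrem.add hH
  rw [zero_add] at hsum
  refine hsum.congr fun k => ?_
  have hk := (ht k).ne'
  simp only [Function.comp_apply, map_smul, smul_apply, smul_sub, smul_smul]
  have e1 : (t k ^ 2)⁻¹ * t k = (t k)⁻¹ := by field_simp
  have e2 : (t k ^ 2)⁻¹ * (1 / 2 * (t k * t k)) = 1 / 2 := by field_simp
  rw [e1, e2, inv_pow]
  abel

/-- Lemma 2, "only if" part. -/
theorem statement_4 {m p : ℕ} (g : Em m → Em p) (yb v : Em m) (I : Set (Fin p))
    (hg : TwiceDiffAt g yb) (hg0 : g yb = 0) (hgv : fderiv ℝ g yb v = 0)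
    (t : ℕ → ℝ) (vk : ℕ → Em m)
    (ht : ∀ k, 0 < t k) (ht0 : Tendsto t atTop (𝓝 0))
    (hvk : Tendsto vk atTop (𝓝 v))
    (hlim : ∀ i ∈ I,
      Tendsto (fun k => (t k)⁻¹ ^ 2 * g (yb + t k • vk k) i) atTop (𝓝 0))
    (hlimsup : ∀ i ∉ I, ∀ ε > (0:ℝ), ∀ᶠ k in atTop,
      (t k)⁻¹ ^ 2 * g (yb + t k • vk k) i ≤ ε) :
    ∃ z : Em m,
      (∀ i ∈ I, fderiv ℝ g yb z i + fderiv ℝ (fderiv ℝ g) yb v v i = 0) ∧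
      ∀ i ∉ I, fderiv ℝ g yb z i + fderiv ℝ (fderiv ℝ g) yb v v i ≤ 0 := by
  let ev : Fin p → Em p →L[ℝ] ℝ := fun i => EuclideanSpace.proj i
  let L : Fin p → Em m →L[ℝ] ℝ := fun i => (ev i).comp (fderiv ℝ g yb)
  let h : Fin p → ℝ := fun i => fderiv ℝ (fderiv ℝ g) yb v v i
  let a : ℕ → Fin p → ℝ := fun k i => L i ((2 * (t k)⁻¹) • vk k)
  have hq := tendsto_second_order_quotient hg.1 hg.2 ht ht0 hvk
  have hqi : ∀ i, Tendsto (fun k => 2 * ((t k)⁻¹ ^ 2 * g (yb + t k • vk k) i) - a k i) atTop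
      (𝓝 (h i)) := by
    intro i
    have h1 := (((ev i).continuous.tendsto _).comp hq).const_mul 2
    refine (h1.congr fun k => ?_).trans_eq ?_
    · simp [ev, L, a, hg0]
      ring
    · simp [ev, h]
  have ha : ∀ i ∈ I, Tendsto (fun k => a k i) atTop (𝓝 (-h i)) := by
    intro i hi
    simpa using ((hlim i hi).const_mul 2).sub (hqi i)
  have hale : ∀ i ∉ I, Tendsto (fun k => max (a k i) (-h i)) atTop (𝓝 (-h i)) := by
    intro i hi
    refine tendsto_order.2 ⟨fun y hy => Eventually.of_forall fun k => lt_max_of_lt_right hy,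
      fun y hy => ?_⟩
    have hε : 0 < (y + h i) / 4 := by linarith
    filter_upwards [hlimsup i hi _ hε,
      (hqi i).eventually_const_lt (show h i - (y + h i) / 4 < h i by linarith)] with k h1 h2
    exact max_lt (by linarith) hy
  classical
  obtain ⟨z, hz1, hz2⟩ := exists_linear_system_of_tendsto L I
    (fun k i => if i ∈ I then a k i else max (a k i) (-h i)) (fun i => -h i)
    (fun i => by
      by_cases hi : i ∈ I
      · simpa [hi] using ha i hi
      · simpa [hi] using hale i hi)
    (fun k => ⟨(2 * (t k)⁻¹) • vk k, fun i hi => by simp only [if_pos hi, a],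
      fun i hi => by simp only [if_neg hi]; exact le_max_left _ _⟩)
  refine ⟨z, fun i hi => ?_, fun i hi => ?_⟩
  · have : fderiv ℝ g yb z i = -h i := hz1 i hi
    linarith
  · have : fderiv ℝ g yb z i ≤ -h i := hz2 i hi
    linarith
end

section
/- Let g : ℝ^m → ℝ^p be twice Fréchet differentiable at ȳ ∈ ℝ^m with g(ȳ) = 0, let I ⊂ {1,…,p} and let v ∈ ℝ^m satisfy ∇g(ȳ)v = 0. If there exists z̄ ∈ ℝ^m with ∇g_i(ȳ)z̄ + vᵀ∇²g_i(ȳ)v = 0 for every i ∈ I and ∇g_i(ȳ)z̄ + vᵀ∇²g_i(ȳ)v ≤ 0 for every i ∈ {1,…,p}∖I, then there exist sequences t_k ↓ 0 and v_k → v such that lim_{k→∞} t_k⁻² g_i(ȳ + t_k v_k) = 0 for every i ∈ I and limsup_{k→∞} t_k⁻² g_i(ȳ + t_k v_k) ≤ 0 for every i ∈ {1,…,p}∖I; indeed one may take v_k := v + (t_k/2) z̄ for any sequence t_k ↓ 0. -/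
open Set Filter Topology Metric RealInnerProductSpace

/-- Second order Taylor formula with Peano remainder. -/
theorem isLittleO_taylor_two_of_differentiableAt_fderiv {E F : Type*}
    [NormedAddCommGroup E] [NormedSpace ℝ E] [NormedAddCommGroup F] [NormedSpace ℝ F]
    {g : E → F} {x : E} (hg : ∀ᶠ y in 𝓝 x, DifferentiableAt ℝ g y)
    (hg' : DifferentiableAt ℝ (fderiv ℝ g) x) :
    (fun h : E => g (x + h) - g x - fderiv ℝ g x h - (1 / 2 : ℝ) • fderiv ℝ (fderiv ℝ g) x h h)
      =o[𝓝 0] fun h => ‖h‖ ^ 2 := by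
  rw [Asymptotics.isLittleO_iff]
  intro c hc
  have h_deriv := (hasFDerivAt_iff_isLittleO_nhds_zero.1 hg'.hasFDerivAt).def hc
  have h_diff : ∀ᶠ h in 𝓝 (0 : E), DifferentiableAt ℝ g (x + h) := by
    have : Tendsto (fun h : E => x + h) (𝓝 0) (𝓝 x) :=
      (continuous_const.add continuous_id).tendsto' 0 x (by simp)
    exact this.eventually hg
  obtain ⟨r, hr, h_ball⟩ := Metric.eventually_nhds_iff_ball.1 (h_deriv.and h_diff)
  filter_upwards [Metric.ball_mem_nhds (0 : E) hr] with h hh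
  have h_mem : ∀ s ∈ Icc (0 : ℝ) 1, s • h ∈ Metric.ball (0 : E) r := by
    intro s hs
    rw [mem_ball_zero_iff] at hh ⊢
    rw [norm_smul, Real.norm_of_nonneg hs.1]
    nlinarith [hs.1, hs.2, norm_nonneg h]
  have key := norm_image_sub_le_of_norm_deriv_le_segment_01' (C := c * ‖h‖ ^ 2)
    (f := fun s : ℝ => g (x + s • h) - s • fderiv ℝ g x h
      - (s ^ 2 / 2) • fderiv ℝ (fderiv ℝ g) x h h)
    (f' := fun s : ℝ => fderiv ℝ g (x + s • h) h - fderiv ℝ g x h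
      - s • fderiv ℝ (fderiv ℝ g) x h h) ?_ ?_
  · have h_eq : g (x + h) - g x - fderiv ℝ g x h - (1 / 2 : ℝ) • fderiv ℝ (fderiv ℝ g) x h h
        = g (x + h) - fderiv ℝ g x h - (1 / 2 : ℝ) • fderiv ℝ (fderiv ℝ g) x h h - g x := by abel
    rw [h_eq]
    simpa using key
  · intro s hs
    have h_line : HasDerivAt (fun s : ℝ => x + s • h) h s := by
      simpa using ((hasDerivAt_id s).smul_const h).const_add x
    have h_comp := (h_ball _ (h_mem s hs)).2.hasFDerivAt.comp_hasDerivAt s h_line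
    have h_lin : HasDerivAt (fun s : ℝ => s • fderiv ℝ g x h) (fderiv ℝ g x h) s := by
      simpa using (hasDerivAt_id s).smul_const (fderiv ℝ g x h)
    have h_sq : HasDerivAt (fun s : ℝ => s ^ 2 / 2) s s := by
      simpa using (hasDerivAt_pow 2 s).div_const 2
    exact ((h_comp.sub h_lin).sub (h_sq.smul_const _)).hasDerivWithinAt
  · intro s hs
    have hs' : s ∈ Icc (0 : ℝ) 1 := ⟨hs.1, hs.2.le⟩
    have h_bound := (h_ball _ (h_mem s hs')).1
    have h_eq : fderiv ℝ g (x + s • h) h - fderiv ℝ g x h - s • fderiv ℝ (fderiv ℝ g) x h h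
        = (fderiv ℝ g (x + s • h) - fderiv ℝ g x - fderiv ℝ (fderiv ℝ g) x (s • h)) h := by
      simp
    rw [h_eq]
    refine (ContinuousLinearMap.le_of_opNorm_le _ h_bound h).trans ?_
    rw [norm_smul, Real.norm_of_nonneg hs.1]
    have : s * (c * ‖h‖ ^ 2) ≤ 1 * (c * ‖h‖ ^ 2) := by gcongr; exact hs'.2
    linarith

/-- Second order expansion of `g` along the parabola `t ↦ x + t v + (t² / 2) z` when the first
order terms vanish. -/
theorem tendsto_inv_sq_smul_along_parabola {E F : Type*}
    [NormedAddCommGroup E] [NormedSpace ℝ E] [NormedAddCommGroup F] [NormedSpace ℝ F]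
    {g : E → F} {x v : E} (hg : ∀ᶠ y in 𝓝 x, DifferentiableAt ℝ g y)
    (hg' : DifferentiableAt ℝ (fderiv ℝ g) x) (hg0 : g x = 0) (hgv : fderiv ℝ g x v = 0)
    (z : E) {ι : Type*} {l : Filter ι} {t : ι → ℝ} (ht : ∀ k, 0 < t k)
    (ht0 : Tendsto t l (𝓝 0)) :
    Tendsto (fun k => (t k)⁻¹ ^ 2 • g (x + t k • (v + (t k / 2) • z))) l
      (𝓝 ((1 / 2 : ℝ) • (fderiv ℝ g x z + fderiv ℝ (fderiv ℝ g) x v v))) := by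
  set A := fderiv ℝ g x
  set B := fderiv ℝ (fderiv ℝ g) x
  set w : ι → E := fun k => v + (t k / 2) • z with hw
  have h_w : Tendsto w l (𝓝 v) := by
    simpa using ((ht0.div_const 2).smul_const z).const_add v
  have h_tw : Tendsto (fun k => t k • w k) l (𝓝 0) := by simpa using ht0.smul h_w
  have h_rem : Tendsto (fun k => (t k)⁻¹ ^ 2 •
      (g (x + t k • w k) - g x - A (t k • w k) - (1 / 2 : ℝ) • B (t k • w k) (t k • w k)))
      l (𝓝 0) := by
    rw [← Asymptotics.isLittleO_one_iff ℝ]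
    have h_o := (isLittleO_taylor_two_of_differentiableAt_fderiv hg hg').comp_tendsto h_tw
    have h_big : (fun k => (t k)⁻¹ ^ 2 • ‖t k • w k‖ ^ 2) =O[l] fun _ => (1 : ℝ) := by
      refine (Tendsto.congr (fun k => ?_) (h_w.norm.pow 2)).isBigO_one ℝ
      have := (ht k).ne'
      rw [norm_smul, Real.norm_of_nonneg (ht k).le, smul_eq_mul]
      field_simp
    exact ((Asymptotics.isBigO_refl (fun k => (t k)⁻¹ ^ 2) l).smul_isLittleO h_o).trans_isBigO
      h_big
  have h_quad : Tendsto (fun k => (1 / 2 : ℝ) • (A z + B (w k) (w k))) l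
      (𝓝 ((1 / 2 : ℝ) • (A z + B v v))) := by
    have h_B : Continuous fun y => B y y := by fun_prop
    exact (((h_B.tendsto v).comp h_w).const_add (A z)).const_smul _
  have h_sum := h_rem.add h_quad
  rw [zero_add] at h_sum
  refine h_sum.congr fun k => ?_
  have h_t := (ht k).ne'
  have h_A : A (t k • w k) = (t k ^ 2 / 2) • A z := by
    simp only [hw, map_smul, map_add, hgv, zero_add, smul_smul]
    congr 1
    ring
  rw [h_A, hg0]
  simp only [map_smul, smul_apply, sub_zero]
  match_scalars <;> field_simp <;> ring

/-- Lemma 2, "if" part, with the explicit choice `v_k = v + (t_k/2) z̄`. -/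
theorem statement_5 {m p : ℕ} (g : Em m → Em p) (yb v : Em m) (I : Set (Fin p))
    (hg : TwiceDiffAt g yb) (hg0 : g yb = 0) (hgv : fderiv ℝ g yb v = 0)
    (zb : Em m)
    (hz1 : ∀ i ∈ I, fderiv ℝ g yb zb i + fderiv ℝ (fderiv ℝ g) yb v v i = 0)
    (hz2 : ∀ i ∉ I, fderiv ℝ g yb zb i + fderiv ℝ (fderiv ℝ g) yb v v i ≤ 0) :
    (∃ (t : ℕ → ℝ) (vk : ℕ → Em m), (∀ k, 0 < t k) ∧ Tendsto t atTop (𝓝 0) ∧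
      Tendsto vk atTop (𝓝 v) ∧
      (∀ i ∈ I, Tendsto (fun k => (t k)⁻¹ ^ 2 * g (yb + t k • vk k) i) atTop (𝓝 0)) ∧
      ∀ i ∉ I, ∀ ε > (0:ℝ), ∀ᶠ k in atTop,
        (t k)⁻¹ ^ 2 * g (yb + t k • vk k) i ≤ ε) ∧
    ∀ t : ℕ → ℝ, (∀ k, 0 < t k) → Tendsto t atTop (𝓝 0) →
      (∀ i ∈ I, Tendsto
        (fun k => (t k)⁻¹ ^ 2 * g (yb + t k • (v + (t k / 2) • zb)) i) atTop (𝓝 0)) ∧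
      ∀ i ∉ I, ∀ ε > (0:ℝ), ∀ᶠ k in atTop,
        (t k)⁻¹ ^ 2 * g (yb + t k • (v + (t k / 2) • zb)) i ≤ ε := by
  have h_all : ∀ t : ℕ → ℝ, (∀ k, 0 < t k) → Tendsto t atTop (𝓝 0) →
      (∀ i ∈ I, Tendsto
        (fun k => (t k)⁻¹ ^ 2 * g (yb + t k • (v + (t k / 2) • zb)) i) atTop (𝓝 0)) ∧
      ∀ i ∉ I, ∀ ε > (0:ℝ), ∀ᶠ k in atTop,
        (t k)⁻¹ ^ 2 * g (yb + t k • (v + (t k / 2) • zb)) i ≤ ε := by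
    intro t ht ht0
    have h_lim : ∀ i, Tendsto (fun k => (t k)⁻¹ ^ 2 * g (yb + t k • (v + (t k / 2) • zb)) i) atTop
        (𝓝 (1 / 2 * (fderiv ℝ g yb zb i + fderiv ℝ (fderiv ℝ g) yb v v i))) := fun i =>
      ((EuclideanSpace.proj (𝕜 := ℝ) i).continuous.tendsto _).comp
        (tendsto_inv_sq_smul_along_parabola hg.1 hg.2 hg0 hgv zb ht ht0)
    refine ⟨fun i hi => ?_, fun i hi ε hε => ?_⟩
    · simpa only [hz1 i hi, mul_zero] using h_lim i
    · exact (h_lim i).eventually_le_const (by linarith [hz2 i hi])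
  have h_pos : ∀ k : ℕ, (0 : ℝ) < 1 / ((k : ℝ) + 1) := fun k => Nat.one_div_pos_of_nat
  have h_zero := tendsto_one_div_add_atTop_nhds_zero_nat (𝕜 := ℝ)
  refine ⟨⟨fun k => 1 / ((k : ℝ) + 1), fun k => v + (1 / ((k : ℝ) + 1) / 2) • zb, h_pos, h_zero,
    ?_, h_all _ h_pos h_zero⟩, h_all⟩
  simpa only [zero_div, zero_smul, add_zero] using
    ((h_zero.div_const 2).smul_const zb).const_add v
end

section
/- Let q : ℝ^m → ℝ^l be twice continuously differentiable, Γ := {y ∈ ℝ^m : q_i(y) ≤ 0, i = 1,…,l}, ȳ ∈ Γ, and let v ∈ T^lin(ȳ). If for every maximal index set Ĵ ∈ J̄(v) the mapping (q_i)_{i∈Ĵ} is 2-regular at ȳ in direction v, then 2-LICQ holds at ȳ in direction v. -/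
open Set Filter Topology Metric RealInnerProductSpace

/-- Second-order Taylor expansion of a `C²` map, with Peano remainder. -/
theorem ContDiff.isLittleO_taylor_two {E F : Type*} [NormedAddCommGroup E] [NormedSpace ℝ E]
    [NormedAddCommGroup F] [NormedSpace ℝ F] {f : E → F} (hf : ContDiff ℝ 2 f) (x : E) :
    (fun h : E => f (x + h) - f x - fderiv ℝ f x h - (1 / 2 : ℝ) • fderiv ℝ (fderiv ℝ f) x h h)
      =o[𝓝 0] fun h : E => ‖h‖ ^ 2 := by
  have hd : Differentiable ℝ f := hf.differentiable two_ne_zero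
  have hd' : Differentiable ℝ (fderiv ℝ f) :=
    (hf.fderiv_right (m := 1) (by norm_num)).differentiable one_ne_zero
  set B := fderiv ℝ (fderiv ℝ f) x
  have hsymm : ∀ v w, B v w = B w v := hf.contDiffAt.isSymmSndFDerivAt (by simp)
  have hder : ∀ h : E, HasFDerivAt
      (fun h : E => f (x + h) - f x - fderiv ℝ f x h - (1 / 2 : ℝ) • B h h)
      (fderiv ℝ f (x + h) - fderiv ℝ f x - B h) h := by
    intro h
    have h1 : HasFDerivAt (fun h : E => f (x + h)) (fderiv ℝ f (x + h)) h := by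
      exact (hd (x + h)).hasFDerivAt.comp h ((hasFDerivAt_id h).const_add x)
    have h2 : HasFDerivAt (fun h : E => B h h) ((2 : ℝ) • B h) h := by
      refine (B.hasFDerivAt.clm_apply (hasFDerivAt_id h)).congr_fderiv ?_
      ext w
      simp [two_smul, hsymm w h]
    refine (((h1.sub_const (f x)).sub (fderiv ℝ f x).hasFDerivAt).sub
      (h2.const_smul (1 / 2 : ℝ))).congr_fderiv ?_
    simp [smul_smul]
  have hlit : (fun h : E => fderiv ℝ f (x + h) - fderiv ℝ f x - B h)
      =o[𝓝[univ] 0] fun h : E => ‖h - 0‖ ^ 1 := by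
    simpa [nhdsWithin_univ] using
      (hasFDerivAt_iff_isLittleO_nhds_zero.1 (hd' x).hasFDerivAt).norm_right
  simpa [nhdsWithin_univ] using convex_univ.isLittleO_pow_succ (mem_univ (0 : E))
    (fun h _ => (hder h).hasFDerivWithinAt) hlit

open scoped Pointwise in
/-- Adjoining a ray whose opposite lies outside a closed cone preserves closedness. -/
theorem PointedCone.isClosed_sup_hull_singleton {F : Type*} [NormedAddCommGroup F]
    [NormedSpace ℝ F] {C : PointedCone ℝ F} (hC : IsClosed (C : Set F)) {a : F} (ha : -a ∉ C) :
    IsClosed ((C ⊔ PointedCone.hull ℝ {a} : PointedCone ℝ F) : Set F) := by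
  obtain ⟨δ, hδ, hball⟩ := Metric.isOpen_iff.1 hC.isOpen_compl (-a) ha
  refine isClosed_of_closure_subset fun x hx => ?_
  set T : ℝ := (‖x‖ + 1) / δ
  have hKclosed : IsClosed ((C : Set F) + (fun t : ℝ => t • a) '' Icc 0 T) :=
    hC.add_right_of_isCompact (isCompact_Icc.image (by fun_prop))
  have hx' : x ∈ closure (((C ⊔ PointedCone.hull ℝ {a} : PointedCone ℝ F) : Set F) ∩ ball x 1) :=
    isOpen_ball.closure_inter ⟨hx, mem_ball_self one_pos⟩
  have hsub : ((C ⊔ PointedCone.hull ℝ {a} : PointedCone ℝ F) : Set F) ∩ ball x 1 ⊆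
      (C : Set F) + (fun t : ℝ => t • a) '' Icc 0 T := by
    rintro z ⟨hz, hzx⟩
    obtain ⟨k, hk, w, hw, rfl⟩ := Submodule.mem_sup.1 hz
    obtain ⟨⟨t, ht⟩, rfl⟩ := Submodule.mem_span_singleton.1 hw
    refine Set.add_mem_add hk ⟨t, ⟨ht, ?_⟩, rfl⟩
    by_contra! hlt
    have hT : 0 ≤ T := by positivity
    have htpos : 0 < t := hT.trans_lt hlt
    have hmem : t⁻¹ • k ∈ C := C.smul_mem (inv_nonneg.2 ht) hk
    have hfar : δ ≤ ‖t⁻¹ • k + a‖ := by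
      by_contra! hlt'
      exact hball (by simpa [mem_ball, dist_eq_norm] using hlt') hmem
    have hnorm : ‖k + t • a‖ = t * ‖t⁻¹ • k + a‖ := by
      rw [← abs_of_pos htpos, ← Real.norm_eq_abs, ← norm_smul, Real.norm_eq_abs,
        abs_of_pos htpos, smul_add, smul_inv_smul₀ htpos.ne']
    have hle : ‖k + t • a‖ < ‖x‖ + 1 := by
      have h1 : ‖k + t • a - x‖ < 1 := by simpa [dist_eq_norm] using hzx
      have h2 := norm_le_norm_add_norm_sub' (k + t • a) x
      linarith
    have h3 : ‖x‖ + 1 < t * δ := (div_lt_iff₀ hδ).1 hlt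
    nlinarith
  have hxK := hKclosed.closure_subset_iff.2 hsub hx'
  obtain ⟨k, hk, _, ⟨t, ht, rfl⟩, rfl⟩ := hxK
  exact Submodule.add_mem_sup hk
    (PointedCone.smul_mem _ ht.1 (PointedCone.subset_hull (mem_singleton a)))

/-- In finite dimension, the sum of a linear subspace and a finitely generated cone is closed. -/
theorem PointedCone.isClosed_ofSubmodule_sup_hull {F : Type*} [NormedAddCommGroup F]
    [NormedSpace ℝ F] [FiniteDimensional ℝ F] {s : Set F} (hs : s.Finite) (S : Submodule ℝ F) :
    IsClosed (((S : PointedCone ℝ F) ⊔ PointedCone.hull ℝ s : PointedCone ℝ F) : Set F) := by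
  induction s, hs using Set.Finite.induction_on generalizing S with
  | empty => simpa using S.closed_of_finiteDimensional
  | @insert a s _ _ ih =>
    by_cases ha : -a ∈ (S : PointedCone ℝ F) ⊔ PointedCone.hull ℝ s
    · convert ih (S ⊔ Submodule.span ℝ {a}) using 2
      refine le_antisymm (sup_le ?_ (Submodule.span_le.2 ?_)) (sup_le ?_ ?_)
      · exact le_sup_of_le_left (PointedCone.ofSubmodule_le_ofSubmodule.2 le_sup_left)
      · refine Set.insert_subset ?_ ?_
        · exact Submodule.mem_sup_left (PointedCone.mem_ofSubmodule_iff.2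
            (Submodule.mem_sup_right (Submodule.mem_span_singleton_self a)))
        · exact fun x hx => Submodule.mem_sup_right (PointedCone.subset_hull hx)
      · intro x hx
        obtain ⟨y, hy, w, hw, rfl⟩ := Submodule.mem_sup.1 (PointedCone.mem_ofSubmodule_iff.1 hx)
        obtain ⟨r, rfl⟩ := Submodule.mem_span_singleton.1 hw
        refine add_mem (Submodule.mem_sup_left hy) ?_
        rcases le_total 0 r with hr | hr
        · exact PointedCone.smul_mem _ hr
            (Submodule.mem_sup_right (PointedCone.subset_hull (mem_insert a s)))
        · rw [← neg_smul_neg]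
          exact PointedCone.smul_mem _ (neg_nonneg.2 hr)
            (sup_le_sup_left (Submodule.span_mono (subset_insert a s)) (S : PointedCone ℝ F) ha)
      · exact le_sup_of_le_right (Submodule.span_mono (subset_insert a s))
    · have h := PointedCone.isClosed_sup_hull_singleton (ih S) ha
      rwa [sup_assoc, sup_comm (PointedCone.hull ℝ s), ← Submodule.span_insert] at h

/-- A finite system of affine equalities (indexed by `I`) and inequalities that can be solved up to
an arbitrarily small error can be solved exactly. -/
theorem LinearMap.exists_nonpos_of_approx {E ι : Type*} [AddCommGroup E] [Module ℝ E] [Fintype ι]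
    (A : E →ₗ[ℝ] ι → ℝ) (b : ι → ℝ) (I : Set ι)
    (happrox : ∀ ε > (0 : ℝ), ∃ z, (∀ i, A z i + b i ≤ ε) ∧ ∀ i ∈ I, -ε ≤ A z i + b i) :
    ∃ z, (∀ i, A z i + b i ≤ 0) ∧ ∀ i ∈ I, A z i + b i = 0 := by
  classical
  set e : ι → ι → ℝ := fun i => Pi.single i 1
  set C : PointedCone ℝ (ι → ℝ) := PointedCone.hull ℝ (e '' Iᶜ)
  have hclosed := PointedCone.isClosed_ofSubmodule_sup_hull (Set.toFinite (e '' Iᶜ))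
    (LinearMap.range A)
  have hmem : -b ∈ ((PointedCone.ofSubmodule (LinearMap.range A) : PointedCone ℝ (ι → ℝ)) ⊔ C : PointedCone ℝ (ι → ℝ)) := by
    rw [← SetLike.mem_coe, ← hclosed.closure_eq, Metric.mem_closure_iff]
    intro ε hε
    obtain ⟨z, hz, hzI⟩ := happrox (ε / 2) (half_pos hε)
    set s : ι → ℝ := fun i => if i ∈ I then 0 else max 0 (-(A z i + b i))
    have hs : s ∈ C := by
      rw [pi_eq_sum_univ' s]
      refine sum_mem fun i _ => ?_
      by_cases hi : i ∈ I
      · simp [s, hi]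
      · exact C.smul_mem (by simp [s, hi]) (PointedCone.subset_hull ⟨i, hi, by
          ext j; simp [e, Pi.single_apply, eq_comm]⟩)
    refine ⟨A z + s, Submodule.add_mem_sup (LinearMap.mem_range_self A z) hs, ?_⟩
    refine ((dist_pi_le_iff (half_pos hε).le).2 fun i => ?_).trans_lt (half_lt_self hε)
    have h1 := hz i
    rw [Real.dist_eq, abs_le]
    by_cases hi : i ∈ I
    · have h2 := hzI i hi
      simp only [s, hi, Pi.add_apply, Pi.neg_apply, if_true]
      constructor <;> linarith
    · simp only [s, hi, Pi.add_apply, Pi.neg_apply, if_false]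
      rcases max_cases 0 (-(A z i + b i)) with h | h <;> constructor <;> linarith
  obtain ⟨_, ⟨z, rfl⟩, c, hc, hsum⟩ := Submodule.mem_sup.1 hmem
  have hcpos : ∀ i, 0 ≤ c i ∧ (i ∈ I → c i = 0) := by
    refine Submodule.span_induction (p := fun c _ => ∀ i, 0 ≤ c i ∧ (i ∈ I → c i = 0))
      ?_ (by simp) ?_ ?_ hc
    · rintro _ ⟨j, hj, rfl⟩ i
      refine ⟨by by_cases h : i = j <;> simp [e, h], fun hi => ?_⟩
      have : i ≠ j := fun h => hj (h ▸ hi)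
      simp [e, this]
    · intro x y _ _ hx hy i
      exact ⟨add_nonneg (hx i).1 (hy i).1, fun hi => by simp [(hx i).2 hi, (hy i).2 hi]⟩
    · intro r x _ hx i
      exact ⟨mul_nonneg r.2 (hx i).1, fun hi => by
        simp [(hx i).2 hi]⟩
  have hval : ∀ i, A z i + b i = -c i := fun i => by
    have h := congrFun hsum i
    simp only [Pi.add_apply, Pi.neg_apply] at h
    linarith
  exact ⟨z, fun i => by rw [hval]; linarith [(hcpos i).1], fun i hi => by
    rw [hval, (hcpos i).2 hi, neg_zero]⟩

theorem TwoRegular.mono {m l : ℕ} {q : Em m → Em l} {yb v : Em m} {I J : Set (Fin l)}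
    (hJ : TwoRegular q yb v J) (hIJ : I ⊆ J) : TwoRegular q yb v I := fun α => by
  obtain ⟨u, w, hu, hw⟩ := hJ α
  exact ⟨u, w, fun i hi => hu i (hIJ hi), fun i hi => hw i (hIJ hi)⟩

theorem exists_maximalJ_superset {m l : ℕ} {q : Em m → Em l} {yb v z : Em m}
    (hz : z ∈ Xibar q yb v) : ∃ J, MaximalJ q yb v J ∧ Jset q yb v z ⊆ J := by
  obtain ⟨J, hle, hJ⟩ := (Set.toFinite (Jbar q yb v)).exists_le_maximal ⟨z, hz, rfl⟩
  exact ⟨J, ⟨hJ.prop, fun J' hJ' h => hJ.eq_of_le hJ' h⟩, hle⟩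

/-- The filter of vectors tending to `0` in direction `v`. -/
noncomputable def dirNhds {H : Type*} [NormedAddCommGroup H] [NormedSpace ℝ H] (v : H) : Filter H :=
  𝓝 0 ⊓ comap (fun h : H => ‖h‖⁻¹ • h) (𝓝 (‖v‖⁻¹ • v))

section DirNhds

variable {H : Type*} [NormedAddCommGroup H] [NormedSpace ℝ H] {v : H}

theorem exists_Vset_of_eventually_dirNhds (hv : v ≠ 0) {P : H → Prop}
    (hP : ∀ᶠ h in dirNhds v, P h) :
    ∃ eps > (0 : ℝ), ∃ delta > (0 : ℝ), ∀ h ∈ Vset eps delta v, h ≠ 0 → P h := by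
  obtain ⟨⟨eps, delta⟩, ⟨heps, hdelta⟩, hsub⟩ :=
    (Metric.nhds_basis_closedBall.inf (Metric.nhds_basis_closedBall.comap _)).eventually_iff.1 hP
  refine ⟨eps, heps, delta, hdelta, fun h hh h0 => hsub ?_⟩
  rw [Vset, if_neg hv] at hh
  rcases hh with hh | ⟨hball, -, hdir⟩
  · exact absurd hh h0
  · exact ⟨hball, by simpa [dist_eq_norm] using hdir⟩

theorem tendsto_dirNhds_smul (hv : v ≠ 0) :
    Tendsto (fun h : H => (‖h‖ / ‖v‖)⁻¹ • h) (dirNhds v) (𝓝 v) := by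
  have h := (tendsto_comap.mono_left inf_le_right :
    Tendsto (fun h : H => ‖h‖⁻¹ • h) (dirNhds v) (𝓝 (‖v‖⁻¹ • v))).const_smul ‖v‖
  rw [smul_inv_smul₀ (norm_ne_zero_iff.2 hv)] at h
  refine h.congr fun x => ?_
  rw [smul_smul, inv_div, div_eq_mul_inv]

variable {F : Type*} [NormedAddCommGroup F] [NormedSpace ℝ F] {f : H → F}

/-- Difference quotients in direction `v` converge to the directional derivative. -/
theorem HasFDerivAt.tendsto_dirNhds {f' : H →L[ℝ] F} {x : H} (hf : HasFDerivAt f f' x)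
    (hv : v ≠ 0) :
    Tendsto (fun h : H => (‖h‖ / ‖v‖)⁻¹ • (f (x + h) - f x)) (dirNhds v) (𝓝 (f' v)) := by
  have hrem : Tendsto (fun h : H => (‖h‖ / ‖v‖)⁻¹ • (f (x + h) - f x - f' h))
      (dirNhds v) (𝓝 0) := by
    have hO := (hasFDerivAt_iff_isLittleO_nhds_zero.1 hf).norm_right.mono
      (inf_le_left : dirNhds v ≤ 𝓝 0)
    have h1 := ((hO.norm_left.tendsto_div_nhds_zero).const_mul ‖v‖)
    rw [mul_zero] at h1
    refine squeeze_zero_norm (fun h => le_of_eq ?_) h1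
    rw [norm_smul, norm_inv, norm_div, norm_norm, norm_norm, inv_div]
    ring
  have hlin := (f'.continuous.tendsto v).comp (tendsto_dirNhds_smul hv)
  have hsum := hrem.add hlin
  rw [zero_add] at hsum
  refine hsum.congr fun h => ?_
  simp [smul_sub]

/-- Parabolic difference quotients in direction `v` converge to the second derivative. -/
theorem ContDiff.tendsto_dirNhds_two (hf : ContDiff ℝ 2 f) (x : H) (hv : v ≠ 0) :
    Tendsto (fun h : H => (2 * (‖h‖ / ‖v‖)⁻¹ ^ 2) • (f (x + h) - f x - fderiv ℝ f x h))
      (dirNhds v) (𝓝 (fderiv ℝ (fderiv ℝ f) x v v)) := by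
  set B := fderiv ℝ (fderiv ℝ f) x
  have hrem : Tendsto (fun h : H => (2 * (‖h‖ / ‖v‖)⁻¹ ^ 2) •
      (f (x + h) - f x - fderiv ℝ f x h - (1 / 2 : ℝ) • B h h)) (dirNhds v) (𝓝 0) := by
    have hO := (hf.isLittleO_taylor_two x).mono (inf_le_left : dirNhds v ≤ 𝓝 0)
    have h1 := ((hO.norm_left.tendsto_div_nhds_zero).const_mul (2 * ‖v‖ ^ 2))
    rw [mul_zero] at h1
    refine squeeze_zero_norm (fun h => le_of_eq ?_) h1
    rw [norm_smul, norm_mul, norm_pow, norm_inv, norm_div, norm_norm, norm_norm, inv_div,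
      Real.norm_two]
    ring
  have hquad : Tendsto (fun h : H => B ((‖h‖ / ‖v‖)⁻¹ • h) ((‖h‖ / ‖v‖)⁻¹ • h))
      (dirNhds v) (𝓝 (B v v)) :=
    ((by fun_prop : Continuous fun h : H => B h h).tendsto v).comp (tendsto_dirNhds_smul hv)
  have hsum := hrem.add hquad
  rw [zero_add] at hsum
  refine hsum.congr fun h => ?_
  simp only [map_smul, smul_apply]
  module

end DirNhds

section ActiveSets

variable {m l : ℕ} {q : Em m → Em l} {yb v : Em m}

theorem eventually_actI_subset (hq : Continuous q) (yb : Em m) :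
    ∀ᶠ h in 𝓝 (0 : Em m), actI q (yb + h) ⊆ actI q yb := by
  have hi : ∀ i, ∀ᶠ h in 𝓝 (0 : Em m), q (yb + h) i = 0 → q yb i = 0 := fun i => by
    by_cases h0 : q yb i = 0
    · simp [h0]
    · have hc : Continuous fun h : Em m => q (yb + h) i := by fun_prop
      filter_upwards [hc.continuousAt.eventually_ne (y := 0) (by simpa using h0)] with h hh h'
      exact absurd h' hh
  filter_upwards [eventually_all.2 hi] with h hh i
  exact hh i

theorem eventually_actI_subset_IbarDir (hq : ContDiff ℝ 2 q) (hv0 : v ≠ 0) :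
    ∀ᶠ h in dirNhds v, actI q (yb + h) ⊆ IbarDir q yb v := by
  have hlim := ((hq.differentiable two_ne_zero) yb).hasFDerivAt.tendsto_dirNhds hv0
  have hi : ∀ i ∈ {i | q yb i = 0}, ∀ᶠ h in dirNhds v,
      q (yb + h) i = 0 → gradQ q yb i v = 0 := fun i hi => by
    have hqi : q yb i = 0 := hi
    by_cases h0 : gradQ q yb i v = 0
    · simp [h0]
    · have hlim_i := ((EuclideanSpace.proj (𝕜 := ℝ) i).continuous.tendsto _).comp hlim
      filter_upwards [hlim_i.eventually_ne h0] with h hh h'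
      exact absurd (by simp [h', hqi]) hh
  filter_upwards [(eventually_all_finite (Set.toFinite _)).2 hi,
    (eventually_actI_subset hq.continuous yb).filter_mono inf_le_left] with h hh hsub i hi
  exact ⟨hsub hi, hh i (hsub hi) hi⟩

theorem eventually_exists_Jset_superset (hq : ContDiff ℝ 2 q) (hv0 : v ≠ 0) :
    ∀ᶠ h in dirNhds v, yb + h ∈ Gam q →
      ∃ z ∈ Xibar q yb v, actI q (yb + h) ⊆ Jset q yb v z := by
  have : Fintype (actI q yb) := Fintype.ofFinite _
  let A : Em m →ₗ[ℝ] actI q yb → ℝ :=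
    { toFun := fun z i => gradQ q yb i z
      map_add' := fun x y => by ext i; simp [gradQ]
      map_smul' := fun r x => by ext i; simp [gradQ] }
  let b : actI q yb → ℝ := fun i => hessQ q yb i v v
  have happrox : ∀ I : Set (actI q yb), ∀ᶠ ε in 𝓝[>] (0 : ℝ),
      (∃ z, (∀ i, A z i + b i ≤ ε) ∧ ∀ i ∈ I, -ε ≤ A z i + b i) →
      ∃ z, (∀ i, A z i + b i ≤ 0) ∧ ∀ i ∈ I, A z i + b i = 0 := fun I => by
    by_cases hex : ∃ z, (∀ i, A z i + b i ≤ 0) ∧ ∀ i ∈ I, A z i + b i = 0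
    · exact Eventually.of_forall fun _ _ => hex
    · have h := mt (A.exists_nonpos_of_approx b I) hex
      push Not at h
      obtain ⟨ε₀, hε₀, hz⟩ := h
      filter_upwards [Ioo_mem_nhdsGT hε₀] with ε hε ⟨z, h1, h2⟩
      obtain ⟨i, hi, hlt⟩ := hz z fun i => (h1 i).trans hε.2.le
      linarith [h2 i hi, hε.2]
  obtain ⟨ε, hε, hεpos⟩ := ((eventually_all.2 happrox).and self_mem_nhdsWithin).exists
  have hlim := hq.tendsto_dirNhds_two yb hv0
  filter_upwards [Metric.tendsto_nhds.1 hlim ε hεpos, eventually_actI_subset_IbarDir hq hv0]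
    with h hclose hsub hGam
  set c : ℝ := 2 * (‖h‖ / ‖v‖)⁻¹ ^ 2
  have hc : 0 ≤ c := by positivity
  have hclose' : ∀ i ∈ actI q yb, |c * q (yb + h) i - (gradQ q yb i (c • h) + hessQ q yb i v v)|
      ≤ ε := fun i hi => by
    have hqi : q yb i = 0 := hi
    rw [dist_eq_norm] at hclose
    have h1 := (PiLp.norm_apply_le _ i).trans hclose.le
    refine le_of_eq_of_le ?_ h1
    rw [Real.norm_eq_abs]
    congr 1
    simp [gradQ, hessQ, hqi]
    ring
  obtain ⟨z, hz, hzI⟩ := hε {i | q (yb + h) i = 0} ⟨c • h, fun i => by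
      have h1 := (abs_le.1 (hclose' i i.2)).1
      have h2 := mul_nonpos_of_nonneg_of_nonpos hc (hGam i)
      change gradQ q yb i (c • h) + hessQ q yb i v v ≤ ε
      linarith, fun i hi => by
      have h1 := (abs_le.1 (hclose' i i.2)).2
      have h2 : q (yb + h) i = 0 := hi
      rw [h2] at h1
      change -ε ≤ gradQ q yb i (c • h) + hessQ q yb i v v
      linarith⟩
  exact ⟨z, fun i hi => hz ⟨i, hi⟩, fun i hi =>
    ⟨hsub hi, hzI ⟨i, (hsub hi).1⟩ hi⟩⟩

end ActiveSets

/-- Proposition 3: sufficient condition for 2-LICQ. -/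
theorem statement_6 {m l : ℕ} (q : Em m → Em l) (hq : ContDiff ℝ 2 q)
    (yb : Em m) (hy : yb ∈ Gam q) (v : Em m) (hv : v ∈ Tlin q yb)
    (h2reg : ∀ J : Set (Fin l), MaximalJ q yb v J → TwoRegular q yb v J) :
    TwoLICQ q yb v := by
  have hreg : ∀ {z : Em m} {I : Set (Fin l)}, z ∈ Xibar q yb v → I ⊆ Jset q yb v z →
      TwoRegular q yb v I := fun hz hI => by
    obtain ⟨J, hJ, hsub⟩ := exists_maximalJ_superset hz
    exact (h2reg J hJ).mono (hI.trans hsub)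
  by_cases hv0 : v = 0
  · obtain ⟨eps, heps, hball⟩ := Metric.nhds_basis_closedBall.eventually_iff.1
      (eventually_actI_subset hq.continuous yb)
    refine ⟨eps, heps, 1, one_pos, fun y hyV _ _ => hreg (z := 0) ?_ fun i hi => ?_⟩
    · intro i _
      simp [gradQ, hessQ, hv0]
    · rw [Vset, if_pos hv0] at hyV
      have h := hball hyV
      rw [add_sub_cancel] at h
      exact ⟨⟨h hi, by simp [gradQ, hv0]⟩, by simp [gradQ, hessQ, hv0]⟩
  · obtain ⟨eps, heps, delta, hdelta, hV⟩ :=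
      exists_Vset_of_eventually_dirNhds hv0 (eventually_exists_Jset_superset hq hv0)
    refine ⟨eps, heps, delta, hdelta, fun y hyV hyG hne => ?_⟩
    have h := hV _ hyV (sub_ne_zero.2 hne)
    rw [add_sub_cancel] at h
    obtain ⟨z, hz, hsub⟩ := h hyG
    exact hreg hz hsub
end
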